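/- Let A be an AW*-algebra with a maximal abelian subalgebra M all of whose nonzero projections are properly infinite in A. Then there is a projection e ∈ M such that e ∼ 1 and 1 − e ∼ 1. -/

import Mathlib

universe u

section Defs

variable {R : Type u} [Ring R] [StarRing R]

/-- An element is a projection if it is self-adjoint and idempotent. -/
def IsProjection (p : R) : Prop := star p = p ∧ p * p = p

/-- Order on projections: `e ≤ f` iff `e = ef`. -/
def ProjLE (e f : R) : Prop := e * f = e

/-- Murray–von Neumann equivalence of projections. -/
def ProjEquiv (e f : R) : Prop := ∃ v : R, star v * v = e ∧ v * star v = f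

/-- `e ≼ f` : `e` is equivalent to a subprojection of `f`. -/
def ProjSubEquiv (e f : R) : Prop :=
  ∃ e' : R, IsProjection e' ∧ ProjLE e' f ∧ ProjEquiv e e'

/-- `e ≺ f` : `e ≼ f` but `e` is not equivalent to `f` (with the convention `0 ≺ 0`). -/
def ProjLT (e f : R) : Prop :=
  (ProjSubEquiv e f ∧ ¬ ProjEquiv e f) ∨ (e = 0 ∧ f = 0)

/-- A central projection. -/
def IsCentralProj (z : R) : Prop := IsProjection z ∧ ∀ a : R, z * a = a * z

/-- `c` is the central cover of `e`: the least central projection above `e`. -/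
def IsCentralCover (e c : R) : Prop :=
  IsCentralProj c ∧ ProjLE e c ∧
    ∀ z : R, IsCentralProj z → ProjLE e z → ProjLE c z

/-- A projection `e` is finite if `e ∼ f ≤ e` implies `f = e`. -/
def ProjFinite (e : R) : Prop :=
  ∀ f : R, IsProjection f → ProjEquiv e f → ProjLE f e → f = e

/-- A nonzero projection is properly infinite if `ze` is infinite
for every central projection `z` with `ze ≠ 0`. -/
def ProperlyInfinite (e : R) : Prop :=
  IsProjection e ∧ e ≠ 0 ∧
    ∀ z : R, IsCentralProj z → z * e ≠ 0 → ¬ ProjFinite (z * e)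

/-- A pairwise orthogonal family of elements. -/
def PairwiseOrthogonal {ι : Type*} (p : ι → R) : Prop :=
  ∀ i j, i ≠ j → p i * p j = 0

/-- `s` is the supremum of the family `p` in the projection order. For an
orthogonal family, this is the sum `Σ pᵢ`. -/
def IsSupProj {ι : Type*} (p : ι → R) (s : R) : Prop :=
  IsProjection s ∧ (∀ i, ProjLE (p i) s) ∧
    ∀ t : R, IsProjection t → (∀ i, ProjLE (p i) t) → ProjLE s t

/-- The family `p` belongs to `Γ(e)`: an orthogonal family of projections,
each equivalent to `e`, with sum (supremum) `e`. -/
def InGamma (e : R) {ι : Type u} (p : ι → R) : Prop :=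
  (∀ i, IsProjection (p i)) ∧ PairwiseOrthogonal p ∧
    (∀ i, ProjEquiv (p i) e) ∧ IsSupProj p e

open Classical in
/-- The dimension `d(e)` of a properly infinite projection: the least cardinal
strictly greater than the cardinality of the index set of every family in
`Γ(e)`, with the convention `d(0) = 0`. -/
noncomputable def projDim (e : R) : Cardinal.{u} :=
  if e = 0 then 0
  else sSup {c : Cardinal.{u} |
    ∃ (ι : Type u) (p : ι → R), InGamma e p ∧ c = Order.succ (Cardinal.mk ι)}

/-- A properly infinite projection `e` is equidimensional if `d(ze) = d(e)`
for every central projection `z` with `ze ≠ 0` (equivalently, for every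
nonzero central projection `z ≤ c(e)`). -/
def Equidimensional (e : R) : Prop :=
  ProperlyInfinite e ∧
    ∀ z : R, IsCentralProj z → z * e ≠ 0 → projDim (z * e) = projDim e

/-- An abelian projection: the corner `eRe` is commutative. -/
def IsAbelianProj (e : R) : Prop :=
  IsProjection e ∧ ∀ a b : R, (e * a * e) * (e * b * e) = (e * b * e) * (e * a * e)

/-- `j` is the join `e ∨ f` in the projection lattice. -/
def IsJoinProj (e f j : R) : Prop :=
  IsProjection j ∧ ProjLE e j ∧ ProjLE f j ∧
    ∀ t : R, IsProjection t → ProjLE e t → ProjLE f t → ProjLE j t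

end Defs

/-- The AW*-condition: the right annihilator of any subset is generated by a
projection: `{a | ∀ s ∈ S, s a = 0} = pR`. -/
def IsAWStarRing (R : Type*) [Ring R] [StarRing R] : Prop :=
  ∀ S : Set R, ∃ p : R, IsProjection p ∧
    {a : R | ∀ s ∈ S, s * a = 0} = {a : R | ∃ b : R, a = p * b}

/-- A maximal abelian (*-sub)algebra. -/
def IsMaximalAbelian {A : Type*} [Ring A] [StarRing A] [Algebra ℂ A] [StarModule ℂ A]
    (M : StarSubalgebra ℂ A) : Prop :=
  (∀ x ∈ M, ∀ y ∈ M, x * y = y * x) ∧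
    ∀ N : StarSubalgebra ℂ A, (∀ x ∈ N, ∀ y ∈ N, x * y = y * x) → M ≤ N → M = N



section Helpers

set_option linter.unusedSectionVars false
set_option linter.unusedSimpArgs false
set_option linter.unusedVariables false

variable {A : Type u} [NormedRing A] [StarRing A] [CStarRing A] [NormedAlgebra ℂ A]
  [StarModule ℂ A] [CompleteSpace A]

def IsSumH {ι : Type*} (p : ι → A) (s : A) : Prop :=
  IsProjection s ∧ (∀ i, s * p i = p i) ∧ ∀ x : A, (∀ i, x * p i = 0) → x * s = 0

def SubE (e f : A) : Prop := ∃ v : A, star v * v = e ∧ f * v = v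

theorem IsProjection.compl {p : A} (h : IsProjection p) : IsProjection (1 - p) := by
  refine ⟨by simp [h.1], ?_⟩
  rw [mul_sub, sub_mul, sub_mul, h.2]; simp

theorem ann_single (hAW : IsAWStarRing A) (S : Set A) :
    ∃ p : A, IsProjection p ∧ (∀ s ∈ S, s * p = 0) ∧ ∀ x, (∀ s ∈ S, s * x = 0) → p * x = x := by
  obtain ⟨p, hp, h⟩ := hAW S
  refine ⟨p, hp, ?_, ?_⟩
  · have : p ∈ {a : A | ∃ b : A, a = p * b} := ⟨p, hp.2.symm⟩
    rw [← h] at this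
    exact this
  · intro x hx
    have : x ∈ {a : A | ∀ s ∈ S, s * a = 0} := hx
    rw [h] at this
    obtain ⟨b, rfl⟩ := this
    rw [← mul_assoc, hp.2]

theorem exists_isSum (hAW : IsAWStarRing A) {ι : Type*} (p : ι → A)
    (hp : ∀ i, IsProjection (p i)) : ∃ s, IsSumH p s := by
  obtain ⟨z, hz, h1, h2⟩ := ann_single hAW (Set.range p)
  have h1' : ∀ i, p i * z = 0 := fun i => h1 _ ⟨i, rfl⟩
  have h3 : ∀ i, z * p i = 0 := fun i => by
    have := congrArg star (h1' i)
    simpa [hz.1, (hp i).1] using this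
  refine ⟨1 - z, hz.compl, fun i => by rw [sub_mul, h3 i]; simp, fun x hx => ?_⟩
  obtain ⟨w, hw, k1, k2⟩ := ann_single hAW {x}
  have k3 : ∀ i, w * p i = p i := fun i => k2 _ (by simpa using hx i)
  have k4 : ∀ i, p i * w = p i := fun i => by
    have := congrArg star (k3 i)
    simpa [hw.1, (hp i).1] using this
  have h4 : z * (1 - w) = 1 - w := h2 _ (by
    rintro _ ⟨i, rfl⟩
    rw [mul_sub, k4 i]; simp)
  have h5 : (1 - w) * z = 1 - w := by
    have := congrArg star h4
    simpa [hw.1, hz.1] using this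
  have h6 : w * (1 - z) = 1 - z := by
    have : (1 - w) * (1 - z) = 0 := by rw [mul_sub, h5]; simp
    rw [sub_mul, one_mul, sub_eq_zero] at this
    exact this.symm
  have : x * w = 0 := k1 x rfl
  rw [← h6, ← mul_assoc, this, zero_mul]

theorem IsSumH.mul_right {ι : Type*} {p : ι → A} {s : A} (h : IsSumH p s)
    (hp : ∀ i, IsProjection (p i)) (i : ι) : p i * s = p i := by
  have := congrArg star (h.2.1 i)
  simpa [h.1.1, (hp i).1] using this

theorem IsSumH.le {ι : Type*} {p : ι → A} {s : A} (h : IsSumH p s) {t : A}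
    (ht : ∀ i, t * p i = p i) : t * s = s := by
  have := h.2.2 (1 - t) (fun i => by rw [sub_mul, ht i]; simp)
  rw [sub_mul, one_mul, sub_eq_zero] at this
  exact this.symm

theorem star_eq_of {a b : A} (ha : IsProjection a) (hb : IsProjection b) (h : a * b = b) :
    b * a = b := by
  have := congrArg star h
  simpa [ha.1, hb.1] using this

theorem star_eq_of' {a b : A} (ha : IsProjection a) (hb : IsProjection b) (h : b * a = b) :
    a * b = b := by
  have := congrArg star h
  simpa [ha.1, hb.1] using this

theorem orth_symm {a b : A} (ha : IsProjection a) (hb : IsProjection b) (h : a * b = 0) :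
    b * a = 0 := by
  have := congrArg star h
  simpa [ha.1, hb.1] using this

theorem IsSumH.unique {ι : Type*} {p : ι → A} {s t : A} (h : IsSumH p s) (h' : IsSumH p t) :
    s = t := by
  have h1 := h.le h'.2.1
  have h2 := h'.le h.2.1
  rw [← h1]; exact star_eq_of h.1 h'.1 h2

theorem IsSumH.orth {ι : Type*} {p : ι → A} {s : A} (h : IsSumH p s) {x : A}
    (hx : ∀ i, x * p i = 0) : x * s = 0 := h.2.2 x hx

theorem IsCentralProj.mul_proj {z p : A} (hz : IsCentralProj z) (hp : IsProjection p) :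
    IsProjection (z * p) := by
  refine ⟨by rw [star_mul, hz.1.1, hp.1, hz.2], ?_⟩
  rw [← mul_assoc, mul_assoc z p z, ← hz.2 p, ← mul_assoc, hz.1.2, mul_assoc, hp.2]

theorem IsCentralProj.mul {z w : A} (hz : IsCentralProj z) (hw : IsCentralProj w) :
    IsCentralProj (z * w) :=
  ⟨hz.mul_proj hw.1, fun a => by rw [mul_assoc, hw.2, ← mul_assoc, hz.2, mul_assoc]⟩

theorem IsCentralProj.compl {z : A} (hz : IsCentralProj z) : IsCentralProj (1 - z) :=
  ⟨hz.1.compl, fun a => by rw [sub_mul, mul_sub, hz.2]; simp⟩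

theorem IsCentralProj.mm {z : A} (hz : IsCentralProj z) (a b : A) :
    (z * a) * (z * b) = z * (a * b) := by
  rw [← mul_assoc, mul_assoc z a z, ← hz.2 a, ← mul_assoc, hz.1.2, mul_assoc]

theorem IsSumH.central {ι : Type*} {p : ι → A} {s z : A} (h : IsSumH p s)
    (hz : IsCentralProj z) : IsSumH (fun i => z * p i) (z * s) := by
  refine ⟨hz.mul_proj h.1, fun i => by rw [hz.mm, h.2.1], fun x hx => ?_⟩
  rw [← mul_assoc]
  exact h.2.2 _ fun i => by rw [mul_assoc]; exact hx i

theorem IsSumH.commute {ι : Type*} {p : ι → A} {s a : A} (h : IsSumH p s)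
    (hp : ∀ i, IsProjection (p i))
    (ha : ∀ i, a * p i = p i * a) : a * s = s * a := by
  have h1 : (1 - s) * a * s = 0 := h.orth fun i => by
    rw [mul_assoc, ha i, ← mul_assoc, sub_mul, h.2.1 i]; simp
  have h2 : (1 - s) * star a * s = 0 := h.orth fun i => by
    have := congrArg star (ha i)
    simp only [star_mul, (hp i).1] at this
    rw [mul_assoc, ← this, ← mul_assoc, sub_mul, h.2.1 i]; simp
  have h3 := congrArg star h2
  simp only [star_mul, star_sub, star_one, h.1.1, star_star, star_zero] at h3
  have e1 : a * s = s * a * s := by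
    rw [sub_mul, sub_mul, one_mul, sub_eq_zero] at h1; exact h1
  have e2 : s * a = s * a * s := by
    rw [← mul_assoc, mul_sub, mul_one, sub_eq_zero] at h3; exact h3
  rw [e1, ← e2]

theorem pi_right {v e : A} (he : IsProjection e) (h : star v * v = e) : v * e = v := by
  have : star (v * e - v) * (v * e - v) = 0 := by
    rw [star_sub, star_mul, he.1, sub_mul, mul_sub, mul_sub]
    have h1 : e * star v * (v * e) = e := by
      rw [mul_assoc, ← mul_assoc (star v), h, he.2, he.2]
    have h2 : e * star v * v = e := by rw [mul_assoc, h, he.2]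
    have h3 : star v * (v * e) = e := by rw [← mul_assoc, h, he.2]
    rw [h1, h2, h3, h]; simp
  rw [CStarRing.star_mul_self_eq_zero_iff, sub_eq_zero] at this
  exact this

theorem pi_proj {v e : A} (he : IsProjection e) (h : star v * v = e) :
    IsProjection (v * star v) := by
  refine ⟨by simp, ?_⟩
  rw [mul_assoc, ← mul_assoc (star v), h, ← mul_assoc, pi_right he h]

theorem pi_left {v e : A} (he : IsProjection e) (h : star v * v = e) :
    (v * star v) * v = v := by
  rw [mul_assoc, h, pi_right he h]

theorem SubE.trans {e f g : A} (h1 : SubE e f) (h2 : SubE f g) : SubE e g := by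
  obtain ⟨v, hv, hv'⟩ := h1
  obtain ⟨w, hw, hw'⟩ := h2
  exact ⟨w * v, by rw [star_mul, mul_assoc, ← mul_assoc (star w), hw, hv', hv],
    by rw [← mul_assoc, hw']⟩

theorem SubE.of_le {e f : A} (he : IsProjection e) (h : f * e = e) : SubE e f :=
  ⟨e, by rw [he.1, he.2], h⟩

theorem SubE.central {e f z : A} (h : SubE e f) (hz : IsCentralProj z) :
    SubE (z * e) (z * f) := by
  obtain ⟨v, hv, hv'⟩ := h
  refine ⟨z * v, ?_, by rw [hz.mm, hv']⟩
  rw [star_mul, hz.1.1, ← hz.2, hz.mm, hv]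

theorem SubE.add {e e' f f' : A} (hf : IsProjection f) (hf' : IsProjection f')
    (h : SubE e f) (h' : SubE e' f') (hff : f * f' = 0) : SubE (e + e') (f + f') := by
  obtain ⟨v, hv, hv'⟩ := h
  obtain ⟨w, hw, hw'⟩ := h'
  have hff' := orth_symm hf hf' hff
  have a1 : star v * w = 0 := by
    rw [← hv', ← hw', star_mul, hf.1, mul_assoc, ← mul_assoc f, hff]; simp
  have a2 : star w * v = 0 := by
    rw [← hv', ← hw', star_mul, hf'.1, mul_assoc, ← mul_assoc f', hff']; simp
  have b1 : f * w = 0 := by rw [← hw', ← mul_assoc, hff, zero_mul]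
  have b2 : f' * v = 0 := by rw [← hv', ← mul_assoc, hff', zero_mul]
  refine ⟨v + w, ?_, ?_⟩
  · rw [star_add, add_mul, mul_add, mul_add, hv, hw, a1, a2]; simp
  · rw [add_mul, mul_add, mul_add, hv', hw', b1, b2]; simp

theorem proj_add {f f' : A} (hf : IsProjection f) (hf' : IsProjection f') (hff : f * f' = 0) :
    IsProjection (f + f') := by
  refine ⟨by rw [star_add, hf.1, hf'.1], ?_⟩
  rw [add_mul, mul_add, mul_add, hf.2, hf'.2, hff, orth_symm hf hf' hff]; simp

theorem proj_sub {f f' : A} (hf : IsProjection f) (hf' : IsProjection f') (hff : f * f' = f') :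
    IsProjection (f - f') := by
  refine ⟨by rw [star_sub, hf.1, hf'.1], ?_⟩
  rw [sub_mul, mul_sub, mul_sub, hf.2, hf'.2, hff, star_eq_of hf hf' hff]; simp

/-- orthogonal additivity -/
theorem orth_additive (hAW : IsAWStarRing A) {ι : Type*} {e f v : ι → A} {E F : A}
    (hE : IsSumH e E) (hF : IsSumH f F)
    (he : ∀ i, IsProjection (e i)) (hf : ∀ i, IsProjection (f i))
    (heo : ∀ i j, i ≠ j → e i * e j = 0) (hfo : ∀ i j, i ≠ j → f i * f j = 0)
    (hv : ∀ i, star (v i) * v i = e i) (hv' : ∀ i, v i * star (v i) = f i)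
    (hEF : E * F = 0) : ∃ V : A, star V * V = E ∧ V * star V = F := by
  have hFE := orth_symm hE.1 hF.1 hEF
  have fe : ∀ i j, f i * e j = 0 := fun i j => by
    rw [← hE.2.1 j, ← hF.mul_right hf i, mul_assoc, ← mul_assoc F, hFE]; simp
  have ef : ∀ i j, e i * f j = 0 := fun i j => orth_symm (hf j) (he i) (fe j i)
  have ve : ∀ i, v i * e i = v i := fun i => pi_right (he i) (hv i)
  have fv : ∀ i, f i * v i = v i := fun i => by rw [← hv' i]; exact pi_left (he i) (hv i)
  have ves : ∀ i, e i * star (v i) = star (v i) := fun i => by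
    have := congrArg star (ve i); simpa [(he i).1] using this
  have fvs : ∀ i, star (v i) * f i = star (v i) := fun i => by
    have := congrArg star (fv i); simpa [(hf i).1] using this
  -- zero products
  have ev : ∀ i j, e i * v j = 0 := fun i j => by rw [← fv j, ← mul_assoc, ef, zero_mul]
  have fvo : ∀ i j, i ≠ j → f i * v j = 0 := fun i j h => by
    rw [← fv j, ← mul_assoc, hfo i j h, zero_mul]
  have evs : ∀ i j, i ≠ j → e i * star (v j) = 0 := fun i j h => by
    rw [← ves j, ← mul_assoc, heo i j h, zero_mul]
  have fvs0 : ∀ i j, f i * star (v j) = 0 := fun i j => by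
    rw [← ves j, ← mul_assoc, fe, zero_mul]
  have vv : ∀ i j, v i * v j = 0 := fun i j => by
    rw [← ve i, mul_assoc, ev, mul_zero]
  have vf : ∀ i j, v i * f j = 0 := fun i j => by
    rw [← ve i, mul_assoc, ef, mul_zero]
  have vse : ∀ i j, star (v i) * e j = 0 := fun i j => by
    rw [← fvs i, mul_assoc, fe, mul_zero]
  have vsvs : ∀ i j, star (v i) * star (v j) = 0 := fun i j => by
    rw [← fvs i, mul_assoc, fvs0, mul_zero]
  let g : ι → A := fun i => (2⁻¹ : ℂ) • (e i + f i + v i + star (v i))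
  have hg : ∀ i, IsProjection (g i) := by
    intro i
    refine ⟨?_, ?_⟩
    · simp only [g, star_smul, star_add, star_star, (he i).1, (hf i).1]
      congr 1
      · simp
      · abel
    · simp only [g, smul_mul_smul_comm, mul_add, add_mul, (he i).2, (hf i).2, ef, fe, ev, fv, ve,
        ves, fvs, fvs0, vv, vf, vse, vsvs, hv, hv']
      have h2 : (2⁻¹ : ℂ) = 2⁻¹ * 2⁻¹ * 2 := by norm_num
      conv_rhs => rw [h2, mul_smul, two_smul]
      congr 1
      abel
  obtain ⟨G, hG⟩ := exists_isSum hAW g hg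
  have key1 : ∀ i, (e i + f i) * g i = g i := by
    intro i
    simp only [g, mul_smul_comm, mul_add, add_mul, (he i).2, (hf i).2, ef, fe, ev, fv, ves, fvs0]
    congr 1; abel
  have key0 : ∀ i j, i ≠ j → (e i + f i) * g j = 0 := by
    intro i j h
    simp only [g, mul_smul_comm, mul_add, add_mul, ef, fe, ev, fvo i j h, evs i j h, fvs0,
      heo i j h, hfo i j h]
    simp
  have efp : ∀ i, IsProjection (e i + f i) := fun i => proj_add (he i) (hf i) (ef i i)
  have key1' : ∀ i, g i * (e i + f i) = g i := fun i => star_eq_of (efp i) (hg i) (key1 i)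
  have key2 : ∀ i, (e i + f i) * G = g i := by
    intro i
    have : ((e i + f i) - g i) * G = 0 := hG.orth fun j => by
      by_cases h : i = j
      · subst h; rw [sub_mul, key1, (hg i).2]; simp
      · rw [sub_mul, key0 i j h, ← key1' i, mul_assoc, key0 i j h]; simp
    rw [sub_mul, sub_eq_zero] at this
    rw [this]; exact hG.mul_right hg i
  have key3 : ∀ i, G * (e i + f i) = g i := fun i => by
    have := congrArg star (key2 i)
    simpa [hG.1.1, (he i).1, (hf i).1, (hg i).1] using this
  have Ge : ∀ i, G * e i = (2⁻¹ : ℂ) • (e i + v i) := fun i => by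
    have : G * e i = (G * (e i + f i)) * e i := by
      rw [mul_assoc, add_mul, (he i).2, fe]; simp
    rw [this, key3]
    simp only [g, smul_mul_assoc, add_mul, (he i).2, fe, ve, vse]
    congr 1; abel
  have Gf : ∀ i, G * f i = (2⁻¹ : ℂ) • (f i + star (v i)) := fun i => by
    have : G * f i = (G * (e i + f i)) * f i := by
      rw [mul_assoc, add_mul, (hf i).2, ef]; simp
    rw [this, key3]
    simp only [g, smul_mul_assoc, add_mul, (hf i).2, ef, vf, fvs]
    congr 1; abel
  have Ff : ∀ i, F * f i = f i := hF.2.1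
  have Ee : ∀ i, E * e i = e i := hE.2.1
  have Fe : ∀ i, F * e i = 0 := fun i => by rw [← Ee i, ← mul_assoc, hFE, zero_mul]
  have Ef : ∀ i, E * f i = 0 := fun i => by rw [← Ff i, ← mul_assoc, hEF, zero_mul]
  have Fv : ∀ i, F * v i = v i := fun i => by rw [← fv i, ← mul_assoc, Ff]
  have Ev : ∀ i, E * v i = 0 := fun i => by rw [← fv i, ← mul_assoc, Ef, zero_mul]
  have Evs : ∀ i, E * star (v i) = star (v i) := fun i => by rw [← ves i, ← mul_assoc, Ee]
  have Fvs : ∀ i, F * star (v i) = 0 := fun i => by rw [← ves i, ← mul_assoc, Fe, zero_mul]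
  have Gv : ∀ i, G * v i = (2⁻¹ : ℂ) • (v i + e i) := fun i => by
    rw [← fv i, ← mul_assoc, Gf, smul_mul_assoc, add_mul, hv]
  have Gvs : ∀ i, G * star (v i) = (2⁻¹ : ℂ) • (star (v i) + f i) := fun i => by
    rw [← ves i, ← mul_assoc, Ge, smul_mul_assoc, add_mul, hv']
  have s2 : star (2 : ℂ) = 2 := by simp
  have h22 : (2 : ℂ) * (2 * (2⁻¹ * 2⁻¹)) = 1 := by norm_num
  refine ⟨(2 : ℂ) • (F * G * E), ?_, ?_⟩
  · have hz : (star ((2 : ℂ) • (F * G * E)) * ((2 : ℂ) • (F * G * E)) - 1) * E = 0 := by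
      refine hE.orth fun i => ?_
      rw [sub_mul, one_mul, sub_eq_zero]
      simp only [star_smul, star_mul, hE.1.1, hF.1.1, hG.1.1, s2, smul_mul_assoc, mul_smul_comm,
        mul_assoc, Ee, Ge, mul_add, Fe, Fv, zero_add, Gv, Ev, smul_smul, h22, one_smul]
    rw [sub_mul, one_mul, sub_eq_zero] at hz
    refine Eq.trans ?_ hz
    simp only [smul_mul_assoc, mul_smul_comm, mul_assoc, hE.1.2]
  · have hz : ((2 : ℂ) • (F * G * E) * star ((2 : ℂ) • (F * G * E)) - 1) * F = 0 := by
      refine hF.orth fun i => ?_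
      rw [sub_mul, one_mul, sub_eq_zero]
      simp only [star_smul, star_mul, hE.1.1, hF.1.1, hG.1.1, s2, smul_mul_assoc, mul_smul_comm,
        mul_assoc, Ee, Ff, Gf, Evs, Ef, Gvs, Fvs, mul_add, Fe, Fv, zero_add, Gv, Ev, smul_smul, h22, one_smul]
    rw [sub_mul, one_mul, sub_eq_zero] at hz
    refine Eq.trans ?_ hz
    simp only [star_smul, star_mul, hE.1.1, hF.1.1, hG.1.1, s2, smul_mul_assoc, mul_smul_comm, mul_assoc, hF.1.2]

theorem SubE.sum (hAW : IsAWStarRing A) {ι : Type*} {e f : ι → A} {E F : A}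
    (hE : IsSumH e E) (hF : IsProjection F) (hFf : ∀ i, F * f i = f i)
    (he : ∀ i, IsProjection (e i)) (hf : ∀ i, IsProjection (f i))
    (heo : ∀ i j, i ≠ j → e i * e j = 0) (hfo : ∀ i j, i ≠ j → f i * f j = 0)
    (hv : ∀ i, SubE (e i) (f i)) (hEF : E * F = 0) : SubE E F := by
  choose v hv hv' using hv
  have hp : ∀ i, IsProjection (v i * star (v i)) := fun i => pi_proj (he i) (hv i)
  obtain ⟨F', hF'⟩ := exists_isSum hAW _ hp
  have hle : F * F' = F' := hF'.le fun i => by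
    rw [← hv' i, mul_assoc (f i), ← mul_assoc F, hFf]
  have hs : ∀ i, star (v i) * f i = star (v i) := fun i => by
    have := congrArg star (hv' i); simpa [(hf i).1] using this
  obtain ⟨V, h1, h2⟩ := orth_additive hAW hE hF' he hp heo (fun i j h => by
    rw [← hs i, ← hv' j]
    have := hfo i j h
    calc v i * (star (v i) * f i) * (f j * v j * star (f j * v j))
        = v i * star (v i) * (f i * f j) * v j * star (f j * v j) := by simp only [mul_assoc]
      _ = 0 := by rw [this]; simp) hv (fun i => rfl) (by rw [← hle, ← mul_assoc, hEF, zero_mul])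
  refine ⟨V, h1, ?_⟩
  have : F' * V = V := by rw [← h2]; exact pi_left hE.1 h1
  rw [← this, ← mul_assoc, hle]

theorem sb (hAW : IsAWStarRing A) {e : A} (he : IsProjection e) (h : SubE 1 e) :
    ProjEquiv e 1 := by
  obtain ⟨v, hv, hv'⟩ := h
  have hvn : ∀ n, star (v ^ n) * v ^ n = 1 := by
    intro n
    induction n with
    | zero => simp
    | succ n ih =>
      rw [pow_succ, star_mul, mul_assoc, ← mul_assoc (star (v ^ n)), ih, one_mul, hv]
  let d := 1 - e
  have hd : IsProjection d := he.compl
  have dv : d * v = 0 := by simp [d, sub_mul, hv']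
  let g : ℕ → A := fun n => v ^ n * d * star (v ^ n)
  have hg : ∀ n, IsProjection (g n) := by
    intro n
    refine ⟨by simp [g, hd.1, mul_assoc], ?_⟩
    calc v ^ n * d * star (v ^ n) * (v ^ n * d * star (v ^ n))
        = v ^ n * d * (star (v ^ n) * v ^ n) * d * star (v ^ n) := by simp only [mul_assoc]
      _ = _ := by rw [hvn, mul_one, mul_assoc _ d d, hd.2]
  obtain ⟨G, hG⟩ := exists_isSum hAW g hg
  have gs : ∀ n, v * g n * star v = g (n + 1) := fun n => by
    simp only [g, pow_succ', star_mul, mul_assoc]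
  have gsv : ∀ n, v * g n = g (n + 1) * v := fun n => by
    rw [← gs, mul_assoc, hv, mul_one]
  have hp : IsProjection (v * G * star v) := by
    refine ⟨by simp [hG.1.1, mul_assoc], ?_⟩
    calc v * G * star v * (v * G * star v) = v * G * (star v * v) * G * star v := by
          simp only [mul_assoc]
      _ = _ := by rw [hv, mul_one, mul_assoc _ G G, hG.1.2]
  have ho : d * (v * G * star v) = 0 := by simp only [← mul_assoc, dv, zero_mul]
  have hs : IsSumH g (d + v * G * star v) := by
    refine ⟨proj_add hd hp ho, ?_, ?_⟩
    · intro n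
      cases n with
      | zero =>
        have := orth_symm hd hp ho
        simp only [g, pow_zero, one_mul, star_one, mul_one, add_mul, hd.2]
        rw [this]; simp
      | succ n =>
        rw [← gs]
        have : d * (v * g n * star v) = 0 := by simp only [← mul_assoc, dv, zero_mul]
        rw [add_mul, this, zero_add]
        calc v * G * star v * (v * g n * star v) = v * (G * (star v * v) * g n) * star v := by
              simp only [mul_assoc]
          _ = _ := by rw [hv, mul_one, hG.2.1]
    · intro x hx
      have h0 : x * d = 0 := by simpa [g] using hx 0
      have h1 : x * v * G = 0 := hG.orth fun n => by
        rw [mul_assoc, gsv, ← mul_assoc, hx, zero_mul]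
      rw [mul_add, h0, ← mul_assoc, ← mul_assoc, h1]; simp
  have hGe := hG.unique hs
  have k1 : G * (v * G * star v) = v * G * star v := by
    have : (d + v * G * star v) * (v * G * star v) = v * G * star v := by
      rw [add_mul, ho, hp.2, zero_add]
    rwa [← hGe] at this
  have k2 : G * (v * G) = v * G := by
    have := congrArg (· * v) k1
    simpa [mul_assoc, hv] using this
  have k3 : G * star v * G = G * star v := by
    have := congrArg star k2
    simpa [mul_assoc, hG.1.1] using this
  let u := v * G + (1 - G)
  have su : star u = G * star v + (1 - G) := by simp [u, hG.1.1]
  have uu : star u * u = 1 := by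
    rw [su]
    simp only [u, add_mul, mul_add, mul_sub, sub_mul, mul_one, one_mul, k2, hG.1.2, k3]
    have : G * star v * (v * G) = G := by
      rw [mul_assoc, ← mul_assoc (star v), hv, one_mul, hG.1.2]
    rw [this]; abel
  have uu' : u * star u = e := by
    rw [su]
    have a1 : v * G * (G * star v) = G - d := by
      rw [mul_assoc, ← mul_assoc G, hG.1.2, ← mul_assoc]
      exact eq_sub_of_add_eq' hGe.symm
    have a2 : v * G * (1 - G) = 0 := by rw [mul_sub, mul_one, mul_assoc, hG.1.2, sub_self]
    have a3 : (1 - G) * (G * star v) = 0 := by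
      rw [← mul_assoc, sub_mul, one_mul, hG.1.2, sub_self, zero_mul]
    simp only [u, add_mul, mul_add, a1, hG.1.compl.2, a2, a3, d]
    abel
  exact ⟨star u, by rw [star_star, uu'], by rw [star_star, uu]⟩


theorem polar (hAW : IsAWStarRing A) {x r : A} (hr : IsProjection r) (hx : x ≠ 0)
    (hxr : x * r = x) :
    ∃ y p : A, IsProjection p ∧ p ≠ 0 ∧ r * p = p ∧ star (x * y) * (x * y) = p := by
  let _ : CStarAlgebra A := {}
  set h := star x * x with hh
  have hsa : IsSelfAdjoint h := IsSelfAdjoint.star_mul_self x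
  have hne : h ≠ 0 := by
    rw [hh, Ne, CStarRing.star_mul_self_eq_zero_iff]; exact hx
  have hn : 0 < ‖h‖ := norm_pos_iff.mpr hne
  set ε := ‖h‖ / 2 with hε
  have hε0 : 0 < ε := by positivity
  let K : ℝ → ℝ := fun t => (√(max t ε))⁻¹
  have hK : Continuous K := by
    refine Continuous.inv₀ (by fun_prop) fun t => ?_
    exact (Real.sqrt_pos.mpr (lt_max_of_lt_right hε0)).ne'
  have hKK : ∀ t, K t * K t = (max t ε)⁻¹ := fun t => by
    simp only [K]
    rw [← mul_inv, Real.mul_self_sqrt (le_max_of_le_right hε0.le)]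
  set k := cfc K h with hk
  have hks : star k = k := (cfc_predicate K h : IsSelfAdjoint (cfc K h))
  have hkh : k * h = h * k := by
    have : Commute (cfc K h) (cfc (id : ℝ → ℝ) h) := cfc_commute_cfc _ _ _
    rw [cfc_id ℝ h] at this
    exact this
  have hkhk : k * h * k = cfc (fun t => K t * t * K t) h := by
    rw [cfc_mul (fun t => K t * t) K h (by fun_prop) (by fun_prop),
      cfc_mul K (fun t => t) h (by fun_prop) (by fun_prop), cfc_id' ℝ h]
  let f := cfc (fun t : ℝ => max (t - ε) 0) h
  have hf0 : f ≠ 0 := by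
    intro h0
    have e1 : h = cfc (fun t : ℝ => min t ε) h + f := by
      conv_lhs => rw [← cfc_id' ℝ h]
      rw [← cfc_add h (fun t : ℝ => min t ε) (fun t : ℝ => max (t - ε) 0) (by fun_prop) (by fun_prop)]
      congr 1
      funext t
      rcases le_total t ε with h | h
      · simp [h]
      · simp [h]
    have e2 : ‖cfc (fun t : ℝ => min t ε) h‖ ≤ ε := by
      refine norm_cfc_le hε0.le fun t ht => ?_
      have : 0 ≤ t := spectrum_star_mul_self_nonneg t ht
      rw [Real.norm_eq_abs, abs_of_nonneg (le_min this hε0.le)]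
      exact min_le_right _ _
    rw [h0, add_zero] at e1
    rw [← e1] at e2
    linarith
  have hf1 : (1 - k * h * k) * f = 0 := by
    rw [hkhk]
    have : (1 : A) = cfc (fun _ : ℝ => (1 : ℝ)) h := by rw [cfc_const_one ℝ h]
    rw [this, ← cfc_sub _ _ h (by fun_prop) (by fun_prop), ← cfc_mul _ _ h (by fun_prop) (by fun_prop)]
    rw [← cfc_const_zero ℝ h]
    congr 1
    funext t
    rcases le_total t ε with h | h
    · simp [h]
    · have ht : 0 < t := hε0.trans_le h
      have : K t * t * K t = 1 := by
        rw [mul_right_comm, hKK, max_eq_left h, inv_mul_cancel₀ ht.ne']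
      rw [this]; simp
  obtain ⟨p, hp, p1, p2⟩ := ann_single hAW {1 - k * h * k}
  have p3 : (1 - k * h * k) * p = 0 := p1 _ rfl
  have hp0 : p ≠ 0 := by
    rintro rfl
    have := p2 f (by simpa using hf1)
    rw [zero_mul] at this
    exact hf0 this.symm
  have hrh : r * h = h := by
    have := congrArg star hxr
    rw [star_mul, hr.1] at this
    rw [hh, ← mul_assoc, this]
  refine ⟨k * p, p, hp, hp0, ?_, ?_⟩
  · have h1 : (1 - r) * (1 - k * h * k) = 1 - r := by
      have : (1 - r) * h = 0 := by rw [sub_mul, hrh]; simp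
      rw [mul_sub, mul_one, hkh, ← mul_assoc, ← mul_assoc, this]; simp
    have h2 : (1 - r) * p = 0 := by rw [← h1, mul_assoc, p3, mul_zero]
    rw [sub_mul, one_mul, sub_eq_zero] at h2
    exact h2.symm
  · have h3 : k * h * k * p = p := by
      rw [sub_mul, one_mul, sub_eq_zero] at p3
      exact p3.symm
    calc star (x * (k * p)) * (x * (k * p)) = p * ((k * (star x * x) * k) * p) := by
          simp only [star_mul, hks, hp.1, mul_assoc]
      _ = p := by rw [← hh, h3, hp.2]

theorem ccover (hAW : IsAWStarRing A) (e : A) : ∃ c : A, IsCentralProj c ∧ c * e = e ∧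
    ∀ w, (∀ x, e * x * w = 0) → c * w = 0 := by
  obtain ⟨p, hp, p1, p2⟩ := ann_single hAW (Set.range fun x => e * x)
  have p1' : ∀ x, e * x * p = 0 := fun x => p1 _ ⟨x, rfl⟩
  have a1 : ∀ y, p * (y * p) = y * p := fun y => p2 _ (by
    rintro _ ⟨x, rfl⟩
    have := p1' (x * y)
    simpa only [mul_assoc] using this)
  have a2 : ∀ y, p * y = y * p := fun y => by
    have h1 := a1 y
    have h2 := congrArg star (a1 (star y))
    simp only [star_mul, star_star, hp.1] at h2
    rw [← h2, mul_assoc, h1]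
  have hc : IsCentralProj p := ⟨hp, a2⟩
  refine ⟨1 - p, hc.compl, ?_, fun w hw => ?_⟩
  · have := p1' 1
    rw [sub_mul, a2, ← mul_one e, this]; simp
  · have := p2 w (by rintro _ ⟨x, rfl⟩; exact hw x)
    rw [sub_mul, this]; simp

theorem max_fam (P : A → Prop) (R : A → A → Prop) (V0 : Set A) (h0 : ∀ v ∈ V0, P v)
    (h0' : ∀ v ∈ V0, ∀ w ∈ V0, v ≠ w → R v w) :
    ∃ V : Set A, V0 ⊆ V ∧ (∀ v ∈ V, P v) ∧ (∀ v ∈ V, ∀ w ∈ V, v ≠ w → R v w) ∧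
      ∀ x, P x → (∀ v ∈ V, R v x ∧ R x v) → x ∈ V := by
  obtain ⟨V, hV0, hV⟩ := zorn_subset_nonempty
    {V : Set A | (∀ v ∈ V, P v) ∧ (∀ v ∈ V, ∀ w ∈ V, v ≠ w → R v w)} (by
      intro c hc hch hne
      refine ⟨⋃₀ c, ⟨?_, ?_⟩, fun s hs => Set.subset_sUnion_of_mem hs⟩
      · rintro v ⟨s, hs, hv⟩
        exact (hc hs).1 v hv
      · rintro v ⟨s, hs, hv⟩ w ⟨t, ht, hw⟩ hvw
        rcases hch.total hs ht with h | h
        · exact (hc ht).2 v (h hv) w hw hvw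
        · exact (hc hs).2 v hv w (h hw) hvw) V0 ⟨h0, h0'⟩
  refine ⟨V, hV0, hV.1.1, hV.1.2, fun x hx hxV => ?_⟩
  have := hV.2 (y := insert x V) ⟨?_, ?_⟩ (Set.subset_insert _ _)
  · exact this (Set.mem_insert _ _)
  · rintro v (rfl | hv)
    · exact hx
    · exact hV.1.1 v hv
  · rintro v (rfl | hv) w (rfl | hw) hvw
    · exact absurd rfl hvw
    · exact (hxV w hw).2
    · exact (hxV v hv).1
    · exact hV.1.2 v hv w hw hvw

theorem compar (hAW : IsAWStarRing A) {r a : A} (hr : IsProjection r) (ha : IsProjection a)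
    (hra : r * a = 0) :
    ∃ z, IsCentralProj z ∧ SubE (z * r) (z * a) ∧ SubE ((1 - z) * a) ((1 - z) * r) := by
  obtain ⟨V, -, hP, hR, hmax⟩ := max_fam
    (fun v : A => IsProjection (star v * v) ∧ a * v = v ∧ v * r = v)
    (fun v w => star v * w = 0 ∧ v * star w = 0) ∅ (by simp) (by simp)
  have he : ∀ v : V, IsProjection (star v.1 * v.1) := fun v => (hP v v.2).1
  have hf : ∀ v : V, IsProjection (v.1 * star v.1) := fun v => pi_proj (he v) rfl
  obtain ⟨E, hE⟩ := exists_isSum hAW _ he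
  obtain ⟨F, hF⟩ := exists_isSum hAW _ hf
  have rE : r * E = E := hE.le fun v => by
    have := congrArg star (hP v v.2).2.2
    rw [star_mul, hr.1] at this
    rw [← mul_assoc, this]
  have aF : a * F = F := hF.le fun v => by rw [← mul_assoc, (hP v v.2).2.1]
  have Er := star_eq_of hr hE.1 rE
  have Fa := star_eq_of ha hF.1 aF
  have EF : E * F = 0 := by
    rw [← Er, ← aF, mul_assoc, ← mul_assoc r, hra]; simp
  have FE := orth_symm hE.1 hF.1 EF
  have heo : ∀ i j : V, i ≠ j → (star i.1 * i.1) * (star j.1 * j.1) = 0 := fun i j h => by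
    have := (hR i i.2 j j.2 (fun h' => h (Subtype.ext h'))).2
    rw [mul_assoc, ← mul_assoc i.1, this]; simp
  have hfo : ∀ i j : V, i ≠ j → (i.1 * star i.1) * (j.1 * star j.1) = 0 := fun i j h => by
    have := (hR i i.2 j j.2 (fun h' => h (Subtype.ext h'))).1
    rw [mul_assoc, ← mul_assoc (star i.1), this]; simp
  obtain ⟨U, hU1, hU2⟩ := orth_additive hAW (v := fun v : V => v.1) hE hF he hf heo hfo
    (fun _ => rfl) (fun _ => rfl) EF
  have s1 : SubE E F := ⟨U, hU1, by rw [← hU2]; exact pi_left hE.1 hU1⟩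
  have s2 : SubE F E := ⟨star U, by simpa using hU2, by
    rw [← hU1]; simpa using pi_left (v := star U) hF.1 (by simpa using hU2)⟩
  have hz : ∀ y, (a - F) * y * (r - E) = 0 := by
    intro y
    by_contra hne
    have hr' := proj_sub hr hE.1 rE
    obtain ⟨k, p, hp, hp0, hrp, hpp⟩ := polar hAW (x := (a - F) * y * (r - E)) hr' hne (by
      rw [mul_assoc, hr'.2])
    set v := (a - F) * y * (r - E) * k with hv
    have Fv : F * v = 0 := by
      rw [hv, mul_assoc, mul_assoc, ← mul_assoc F, mul_sub, Fa, hF.1.2]; simp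
    have av : a * v = v := by
      rw [hv, mul_assoc, mul_assoc, ← mul_assoc a, mul_sub, ha.2, aF]
    have vr' : v * (r - E) = v := by
      rw [← pi_right hp hpp, mul_assoc, star_eq_of hr' hp hrp]
    have vr : v * r = v := by
      rw [← vr', mul_assoc, sub_mul, hr.2, Er]
    have vE : v * E = 0 := by
      rw [← vr', mul_assoc, sub_mul, rE, hE.1.2]; simp
    have Fw : ∀ w ∈ V, F * w = w := fun w hw => by
      have := hF.2.1 ⟨w, hw⟩
      rw [← pi_left (hP w hw).1 rfl, ← mul_assoc, this]
    have Ew : ∀ w ∈ V, w * E = w := fun w hw => by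
      have := hE.mul_right he ⟨w, hw⟩
      have h2 := pi_right (hP w hw).1 rfl
      conv_lhs => rw [← h2, mul_assoc, this]
      exact h2
    have hvV : v ∈ V := by
      refine hmax v ⟨by rw [hpp]; exact hp, av, vr⟩ fun w hw => ?_
      have b1 : star w * v = 0 := by
        rw [← Fw w hw, star_mul, hF.1.1, mul_assoc, Fv, mul_zero]
      have b2 : v * star w = 0 := by
        rw [← Ew w hw, star_mul, hE.1.1, ← mul_assoc, vE, zero_mul]
      refine ⟨⟨b1, ?_⟩, ⟨?_, b2⟩⟩
      · simpa using congrArg star b2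
      · simpa using congrArg star b1
    have := Fw v hvV
    rw [Fv] at this
    rw [← this] at hpp
    exact hp0 (by rw [← hpp]; simp)
  obtain ⟨c, hc, hc1, hc2⟩ := ccover hAW (a - F)
  have hc3 := hc2 (r - E) hz
  refine ⟨c, hc, ?_, ?_⟩
  · rw [mul_sub, sub_eq_zero] at hc3
    rw [hc3]
    exact (s1.central hc).trans (.of_le (hc.mul_proj hF.1) (by rw [hc.mm, aF]))
  · have : (1 - c) * a = (1 - c) * F := by
      rw [← sub_eq_zero, ← mul_sub, sub_mul, hc1]; simp
    rw [this]
    exact (s2.central hc.compl).trans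
      (.of_le (hc.compl.mul_proj hE.1) (by rw [hc.compl.mm, rE]))

def FamH (a b : A) {ι : Type*} (w : ι → A) : Prop :=
  (∀ i, star (w i) * w i = a) ∧ (∀ i, b * w i = w i) ∧ ∀ i j, i ≠ j → star (w i) * w j = 0

theorem FamH.proj {a b : A} {ι : Type*} {w : ι → A} (h : FamH a b w) (ha : IsProjection a)
    (i : ι) : IsProjection (w i * star (w i)) := pi_proj ha (h.1 i)

theorem FamH.orth {a b : A} {ι : Type*} {w : ι → A} (h : FamH a b w)
    (i j : ι) (hij : i ≠ j) : (w i * star (w i)) * (w j * star (w j)) = 0 := by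
  rw [mul_assoc, ← mul_assoc (star (w i)), h.2.2 i j hij]; simp

theorem FamH.central {a b z : A} {ι : Type*} {w : ι → A} (h : FamH a b w)
    (hz : IsCentralProj z) : FamH (z * a) (z * b) (fun i => z * w i) := by
  refine ⟨fun i => ?_, fun i => by rw [hz.mm, h.2.1], fun i j hij => ?_⟩
  · rw [star_mul, hz.1.1, ← hz.2, hz.mm, h.1]
  · rw [star_mul, hz.1.1, ← hz.2, hz.mm, h.2.2 i j hij, mul_zero]

theorem FamH.comp {a b : A} {ι κ : Type*} {w : ι → A} (h : FamH a b w)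
    (f : κ → ι) (hf : Function.Injective f) : FamH a b (fun i => w (f i)) :=
  ⟨fun i => h.1 _, fun i => h.2.1 _, fun i j hij => h.2.2 _ _ fun h' => hij (hf h')⟩

theorem lemE (hAW : IsAWStarRing A) {a b : A} (ha : IsProjection a) (hb : IsProjection b)
    (ha0 : a ≠ 0) (W0 : Set A) (haW : a ∈ W0) (hW0 : FamH a b (fun w : W0 => w.1)) :
    ∃ W : Set A, W0 ⊆ W ∧ FamH a b (fun w : W => w.1) ∧ ∃ S,
      IsSumH (fun w : W => w.1 * star w.1) S ∧ b * S = S ∧ ∃ z, IsCentralProj z ∧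
        z * a ≠ 0 ∧ SubE (z * (b - S)) (z * a) := by
  obtain ⟨W, hWW, hP, hR, hmax⟩ := max_fam
    (fun v : A => star v * v = a ∧ b * v = v)
    (fun v w => star v * w = 0) W0 (fun v hv => ⟨hW0.1 ⟨v, hv⟩, hW0.2.1 ⟨v, hv⟩⟩)
    (fun v hv w hw hvw => hW0.2.2 ⟨v, hv⟩ ⟨w, hw⟩ (fun h => hvw (congrArg Subtype.val h)))
  have hW : FamH a b (fun w : W => w.1) := ⟨fun i => (hP i i.2).1, fun i => (hP i i.2).2,
    fun i j hij => hR i i.2 j j.2 fun h => hij (Subtype.ext h)⟩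
  obtain ⟨S, hS⟩ := exists_isSum hAW _ (hW.proj ha)
  have bS : b * S = S := hS.le fun i => by rw [← mul_assoc, hW.2.1]
  have Sb := star_eq_of hb hS.1 bS
  have Sw : ∀ w ∈ W, S * w = w := fun w hw => by
    have := hS.2.1 ⟨w, hw⟩
    rw [← pi_left ha (hP w hw).1, ← mul_assoc, this]
  have Sa : S * a = a := Sw a (hWW haW)
  have hr := proj_sub hb hS.1 bS
  have hrS : (b - S) * S = 0 := by rw [sub_mul, bS, hS.1.2, sub_self]
  have hSr := orth_symm hr hS.1 hrS
  obtain ⟨z, hz, z1, z2⟩ := compar hAW hr ha (by rw [← Sa, ← mul_assoc, hrS, zero_mul])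
  refine ⟨W, hWW, hW, S, hS, bS, z, hz, fun hza => ?_, z1⟩
  rw [sub_mul, one_mul, hza, sub_zero] at z2
  obtain ⟨v, hv, hv'⟩ := z2.trans (SubE.of_le (hz.compl.mul_proj hr) (f := b - S)
    (by rw [← mul_assoc, ← hz.compl.2, mul_assoc, hr.2]))
  have Sv : S * v = 0 := by rw [← hv', ← mul_assoc, hSr, zero_mul]
  have : v ∈ W := by
    refine hmax v ⟨hv, ?_⟩ fun w hw => ?_
    · rw [← hv', ← mul_assoc, mul_sub, hb.2, bS]
    · have : star w * v = 0 := by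
        rw [← Sw w hw, star_mul, hS.1.1, mul_assoc, Sv, mul_zero]
      refine ⟨this, ?_⟩
      simpa using congrArg star this
  have h1 := Sw v this
  rw [Sv] at h1
  rw [← h1] at hv
  exact ha0 (by rw [← hv]; simp)


theorem sX_orth {I : Type*} {e : I → A} (he : ∀ i, IsProjection (e i))
    (heo : ∀ i j, i ≠ j → e i * e j = 0) {X Y : Set I} (hd : Disjoint X Y) {s t : A}
    (hs : IsSumH (fun i : X => e i) s) (ht : IsSumH (fun i : Y => e i) t) : s * t = 0 := by
  refine ht.orth fun j => ?_
  refine orth_symm (he j) hs.1 (hs.orth fun i => heo _ _ ?_)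
  intro h
  exact Set.disjoint_left.mp hd i.2 (h ▸ j.2)

theorem sX_union {I : Type*} {e : I → A} (he : ∀ i, IsProjection (e i))
    (heo : ∀ i j, i ≠ j → e i * e j = 0) {X Y : Set I} (hd : Disjoint X Y) {s t : A}
    (hs : IsSumH (fun i : X => e i) s) (ht : IsSumH (fun i : Y => e i) t) :
    IsSumH (fun i : ↥(X ∪ Y) => e i) (s + t) := by
  have h0 := sX_orth he heo hd hs ht
  have h0' := orth_symm hs.1 ht.1 h0
  refine ⟨proj_add hs.1 ht.1 h0, ?_, fun x hx => ?_⟩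
  · rintro ⟨i, hi | hi⟩
    · have := hs.2.1 ⟨i, hi⟩
      dsimp only at this ⊢
      rw [← this, add_mul, ← mul_assoc t, h0', ← mul_assoc s, hs.1.2]; simp
    · have := ht.2.1 ⟨i, hi⟩
      dsimp only at this ⊢
      rw [← this, add_mul, ← mul_assoc s, h0, ← mul_assoc t, ht.1.2]; simp
  · rw [mul_add, hs.orth fun i => hx ⟨i, Or.inl i.2⟩, ht.orth fun i => hx ⟨i, Or.inr i.2⟩, add_zero]

theorem sX_sub (hAW : IsAWStarRing A) {I : Type*} {e : I → A} (he : ∀ i, IsProjection (e i))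
    (heo : ∀ i j, i ≠ j → e i * e j = 0) (hc : ∀ i j, SubE (e i) (e j))
    {X Y : Set I} (hd : Disjoint X Y) {s t : A}
    (hs : IsSumH (fun i : X => e i) s) (ht : IsSumH (fun i : Y => e i) t)
    (f : I → I) (hf : Function.Injective f) (hfY : ∀ i, f i ∈ Y) : SubE s t :=
  SubE.sum hAW hs ht.1 (f := fun i : X => e (f i)) (fun i => ht.2.1 ⟨f i, hfY i⟩)
    (fun i => he _) (fun i => he _) (fun i j h => heo _ _ fun h' => h (Subtype.ext h'))
    (fun i j h => heo _ _ fun h' => h (Subtype.ext (hf h')))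
    (fun i => hc _ _) (sX_orth he heo hd hs ht)

theorem lemL (hAW : IsAWStarRing A) {I : Type*} {e : I → A} (he : ∀ i, IsProjection (e i))
    (heo : ∀ i j, i ≠ j → e i * e j = 0) (hc : ∀ i j, SubE (e i) (e j))
    {X Y : Set I} (hd : Disjoint X Y) {S s t : A} (hS : IsSumH e S)
    (hs : IsSumH (fun i : X => e i) s) (ht : IsSumH (fun i : Y => e i) t)
    (f : I → I) (hf : Function.Injective f) (hfX : ∀ i, f i ∈ X)
    (g : I → I) (hg : Function.Injective g) (hgY : ∀ i, g i ∈ Y) : SubE S (s + t) := by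
  obtain ⟨c, hcc⟩ := exists_isSum hAW (fun i : ↥(Yᶜ) => e i) (fun i => he _)
  have hdc : Disjoint Yᶜ Y := disjoint_compl_left
  have hu := sX_union he heo hdc hcc ht
  have hSu : S = c + t := by
    refine hS.unique ⟨hu.1, fun i => ?_, fun x hx => hu.2.2 x fun i => hx i⟩
    exact hu.2.1 ⟨i, by rw [Set.compl_union_self]; trivial⟩
  have h1 := sX_sub hAW he heo hc hdc hcc ht g hg hgY
  have h2 := sX_sub hAW he heo hc hd.symm ht hs f hf hfX
  rw [hSu]
  exact SubE.add hs.1 ht.1 (h1.trans h2) (.of_le ht.1 ht.1.2) (sX_orth he heo hd hs ht)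

theorem lemD (hAW : IsAWStarRing A) {I : Type*} [Infinite I] {w : I → A} {a b S : A}
    (ha : IsProjection a) (hb : IsProjection b)
    (hw : FamH a b w) (hS : IsSumH (fun i => w i * star (w i)) S)
    (hr : SubE (b - S) a) : ∃ w' : I → A, FamH b b w' := by
  have he := hw.proj ha
  have heo := hw.orth
  set e : I → A := fun i => w i * star (w i) with hedef
  have hwa : ∀ i, w i * a = w i := fun i => pi_right ha (hw.1 i)
  have haw : ∀ i, a * star (w i) = star (w i) := fun i => by
    have := congrArg star (hwa i); simpa [ha.1] using this
  have hae : ∀ i, SubE a (e i) := fun i => ⟨w i, hw.1 i, pi_left ha (hw.1 i)⟩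
  have hea : ∀ i, SubE (e i) a := fun i => ⟨star (w i), by simp [hedef], haw i⟩
  have hc : ∀ i j, SubE (e i) (e j) := fun i j => (hea i).trans (hae j)
  obtain ⟨θ⟩ : Nonempty (I × I ≃ I) := by
    rw [← Cardinal.eq, Cardinal.mk_prod, Cardinal.lift_id]
    exact Cardinal.mul_eq_self (Cardinal.aleph0_le_mk I)
  let n : ℕ ↪ I := Infinite.natEmbedding I
  let φ : ℕ → I → I → I := fun k i j => θ (n k, θ (i, j))
  have hφ : ∀ k i j k' i' j', φ k i j = φ k' i' j' → k = k' ∧ i = i' ∧ j = j' := by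
    intro k i j k' i' j' h
    have h1 := θ.injective h
    rw [Prod.mk.injEq] at h1
    have h2 := θ.injective h1.2
    rw [Prod.mk.injEq] at h2
    exact ⟨n.injective h1.1, h2⟩
  let X : ℕ → I → Set I := fun k i => Set.range (φ k i)
  have hX : ∀ k i k' i', (k ≠ k' ∨ i ≠ i') → Disjoint (X k i) (X k' i') := by
    intro k i k' i' h
    rw [Set.disjoint_left]
    rintro _ ⟨j, rfl⟩ ⟨j', h'⟩
    have := hφ _ _ _ _ _ _ h'
    rcases h with h | h
    · exact h this.1.symm
    · exact h this.2.1.symm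
  have hφi : ∀ k i, Function.Injective (φ k i) := fun k i j j' h => (hφ _ _ _ _ _ _ h).2.2
  choose s hs using fun Y : Set I => exists_isSum hAW (fun i : Y => e i) (fun i => he i)
  let Y : I → Set I := fun i => (X 0 i ∪ X 1 i) ∪ X 2 i
  have hYd : ∀ i j, i ≠ j → Disjoint (Y i) (Y j) := by
    intro i j h
    have := fun k k' => hX k i k' j (Or.inr h)
    simp only [Y, Set.disjoint_union_left, Set.disjoint_union_right, this, and_self]
  have key : ∀ i, SubE b (s (Y i)) := by
    intro i
    have d1 : Disjoint (X 0 i) (X 1 i) := hX _ _ _ _ (Or.inl (by norm_num))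
    have d2 : Disjoint (X 0 i ∪ X 1 i) (X 2 i) := by
      rw [Set.disjoint_union_left]
      exact ⟨hX _ _ _ _ (Or.inl (by norm_num)), hX _ _ _ _ (Or.inl (by norm_num))⟩
    have u1 := sX_union he heo d1 (hs _) (hs _)
    have u2 := sX_union he heo d2 u1 (hs _)
    have l := lemL hAW he heo hc d1 hS (hs _) (hs _) (φ 0 i) (hφi _ _) (fun j => ⟨j, rfl⟩)
      (φ 1 i) (hφi _ _) (fun j => ⟨j, rfl⟩)
    have hr2 : SubE (b - S) (s (X 2 i)) := (hr.trans (hae (φ 2 i i))).trans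
      (.of_le (he _) ((hs (X 2 i)).2.1 ⟨φ 2 i i, ⟨i, rfl⟩⟩))
    have := SubE.add u1.1 (hs (X 2 i)).1 l hr2 (sX_orth he heo d2 u1 (hs _))
    rw [add_sub_cancel, u2.unique (hs (Y i))] at this
    exact this
  choose w' h1 h2 using key
  refine ⟨w', h1, fun i => ?_, fun i j hij => ?_⟩
  · have : b * s (Y i) = s (Y i) := (hs (Y i)).le fun j => by
      simp only [hedef]; rw [← mul_assoc, hw.2.1]
    rw [← h2 i, ← mul_assoc, this]
  · have := sX_orth he heo (hYd i j hij) (hs _) (hs _)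
    rw [← h2 i, ← h2 j, star_mul, (hs (Y i)).1.1, mul_assoc, ← mul_assoc (s (Y i)), this]; simp


theorem FamH.inj {a b : A} {ι : Type*} {w : ι → A} (h : FamH a b w) (ha : a ≠ 0) :
    Function.Injective w := by
  intro i j hij
  by_contra hne
  apply ha
  rw [← h.1 i]
  nth_rw 2 [hij]
  exact h.2.2 i j hne

theorem FamH.cut {a b z S : A} {ι : Type*} {w : ι → A} (h : FamH a b w)
    (hS : IsSumH (fun i => w i * star (w i)) S)
    (hz : IsCentralProj z) : IsSumH (fun i => (z * w i) * star (z * w i)) (z * S) := by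
  have := hS.central hz
  convert this using 2 with i
  rw [star_mul, hz.1.1, ← hz.2, hz.mm]

theorem doubling (hAW : IsAWStarRing A) {p : A} (hp : IsProjection p) (hinf : ¬ ProjFinite p) :
    ∃ z, IsCentralProj z ∧ z * p ≠ 0 ∧ ∃ w : ℕ → A, FamH (z * p) (z * p) w := by
  unfold ProjFinite at hinf
  push Not at hinf
  obtain ⟨f, hf, ⟨v, hv, hvf⟩, hfp, hne⟩ := hinf
  have hfp' : f * p = f := hfp
  have pf : p * f = f := star_eq_of' hp hf hfp'
  have fv : f * v = v := by rw [← hvf]; exact pi_left hp hv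
  have pv : p * v = v := by rw [← fv, ← mul_assoc, pf]
  have hd : IsProjection (p - f) := proj_sub hp hf pf
  have hd0 : p - f ≠ 0 := fun h => hne (sub_eq_zero.1 h).symm
  have hdv : (p - f) * v = 0 := by rw [sub_mul, pv, fv, sub_self]
  have pd : p * (p - f) = p - f := by rw [mul_sub, hp.2, pf]
  let w : ℕ → A := fun n => Nat.rec (p - f) (fun _ x => v * x) n
  have w0 : w 0 = p - f := rfl
  have ws : ∀ n, w (n + 1) = v * w n := fun n => rfl
  have pw : ∀ n, p * w n = w n := by
    intro n
    cases n with
    | zero => exact pd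
    | succ n => rw [ws, ← mul_assoc, pv]
  have hss : ∀ m n, star (w (m + 1)) * w (n + 1) = star (w m) * w n := by
    intro m n
    rw [ws, ws, star_mul, mul_assoc, ← mul_assoc (star v), hv, pw]
  have h0s : ∀ n, star (w 0) * w (n + 1) = 0 := by
    intro n
    rw [ws, w0, hd.1, ← mul_assoc, hdv, zero_mul]
  have hs0 : ∀ n, star (w (n + 1)) * w 0 = 0 := by
    intro n
    have := congrArg star (h0s n)
    simpa using this
  have hfam : FamH (p - f) p w := by
    refine ⟨?_, pw, ?_⟩
    · intro n
      induction n with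
      | zero => rw [w0, hd.1, hd.2]
      | succ n ih => rw [hss, ih]
    · intro i
      induction i with
      | zero =>
        intro j hj
        cases j with
        | zero => exact absurd rfl hj
        | succ j => exact h0s j
      | succ i ih =>
        intro j hj
        cases j with
        | zero => exact hs0 i
        | succ j => rw [hss]; exact ih j (fun h => hj (by rw [h]))
  have hinj := hfam.inj hd0
  have hW0 : FamH (p - f) p (fun x : Set.range w => x.1) := by
    refine ⟨?_, ?_, ?_⟩
    · rintro ⟨_, n, rfl⟩; exact hfam.1 n
    · rintro ⟨_, n, rfl⟩; exact hfam.2.1 n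
    · rintro ⟨_, n, rfl⟩ ⟨_, m, rfl⟩ hnm
      exact hfam.2.2 n m (fun h => hnm (by subst h; rfl))
  obtain ⟨W, hWW, hW, S, hS, pS, z, hz, hz0, hzr⟩ :=
    lemE hAW hd hp hd0 (Set.range w) ⟨0, rfl⟩ hW0
  have : Infinite W := by
    have h1 : (Set.range w).Infinite := Set.infinite_range_of_injective hinj
    exact (h1.mono hWW).to_subtype
  obtain ⟨w', hw'⟩ := lemD hAW (hz.mul_proj hd) (hz.mul_proj hp) (hW.central hz) (hW.cut hS hz)
    (by rw [← mul_sub]; exact hzr)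
  refine ⟨z, hz, ?_, _, hw'.comp _ (Infinite.natEmbedding W).injective⟩
  intro h
  apply hz0
  rw [← pd, ← mul_assoc, h, zero_mul]

theorem lemX0 (hAW : IsAWStarRing A) {I : Type*} {w y : I → A} {x : ℕ → A} {a b S : A} (i0 : I)
    (ha : IsProjection a) (hb : IsProjection b) (hw : FamH a b w) (hi0 : w i0 = a)
    (hS : IsSumH (fun i => w i * star (w i)) S) (hr : SubE (b - S) a)
    (hy : FamH a a y) (hx : FamH a a x) : SubE b a := by
  have he := hw.proj ha
  have heo := hw.orth
  have e0 : w i0 * star (w i0) = a := by rw [hi0, ha.1, ha.2]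
  obtain ⟨T, hT⟩ := exists_isSum hAW (fun i : {i // i ≠ i0} => w i.1 * star (w i.1))
    (fun i => he i.1)
  have aT : a * T = 0 := hT.orth (fun i => by
    have := heo i0 i.1 (fun h => i.2 h.symm)
    rwa [e0] at this)
  have Ta : T * a = 0 := orth_symm ha hT.1 aT
  have hST : S = a + T := by
    refine hS.unique ⟨proj_add ha hT.1 aT, ?_, ?_⟩
    · intro i
      by_cases h : i = i0
      · subst h
        show (a + T) * (w i * star (w i)) = w i * star (w i)
        rw [e0, add_mul, ha.2, Ta, add_zero]
      · have h1 := hT.2.1 ⟨i, h⟩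
        have h2 := heo i0 i (fun h' => h h'.symm)
        rw [e0] at h2
        show (a + T) * (w i * star (w i)) = w i * star (w i)
        rw [add_mul, h2, zero_add]
        exact h1
    · intro u hu
      have h1 : u * a = 0 := by
        have := hu i0
        simp only [e0] at this
        exact this
      rw [mul_add, h1, zero_add]
      exact hT.2.2 u (fun i => hu i.1)
  have aw : ∀ i, a * star (w i) = star (w i) := fun i => by
    have := congrArg star (pi_right ha (hw.1 i))
    simpa [ha.1] using this
  have hTa : SubE T a := by
    refine SubE.sum hAW (f := fun i : {i // i ≠ i0} => y i.1 * star (y i.1)) hT ha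
      (fun i => ?_) (fun i => he i.1) (fun i => hy.proj ha i.1)
      (fun i j hij => heo _ _ (fun h => hij (Subtype.ext h)))
      (fun i j hij => hy.orth _ _ (fun h => hij (Subtype.ext h))) (fun i => ?_) Ta
    · rw [← mul_assoc, hy.2.1]
    · have h1 : SubE (w i.1 * star (w i.1)) a := ⟨star (w i.1), by simp, aw i.1⟩
      exact h1.trans ⟨y i.1, hy.1 _, pi_left ha (hy.1 _)⟩
  have hax : ∀ n, SubE a (x n * star (x n)) := fun n => ⟨x n, hx.1 n, pi_left ha (hx.1 n)⟩
  have g := hx.proj ha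
  have go := hx.orth
  have g01 := proj_add (g 0) (g 1) (go 0 1 (by norm_num))
  have go2 : (x 0 * star (x 0) + x 1 * star (x 1)) * (x 2 * star (x 2)) = 0 := by
    rw [add_mul, go 0 2 (by norm_num), go 1 2 (by norm_num), add_zero]
  have h3 := SubE.add g01 (g 2) (SubE.add (g 0) (g 1) (hax 0) (hTa.trans (hax 1))
    (go 0 1 (by norm_num))) (hr.trans (hax 2)) go2
  have hb' : a + T + (b - S) = b := by rw [hST]; abel
  rw [hb'] at h3
  refine h3.trans (SubE.of_le (proj_add g01 (g 2) go2) ?_)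
  simp only [mul_add, ← mul_assoc, hx.2.1]

theorem lemX (hAW : IsAWStarRing A) {a b : A} (ha : IsProjection a) (hb : IsProjection b)
    (ha0 : a ≠ 0) (hab : b * a = a) (m : Cardinal.{u})
    (hinf : ∀ z, IsCentralProj z → z * a ≠ 0 → ¬ ProjFinite (z * a))
    (hq : ∀ z, IsCentralProj z → z * b ≠ 0 → ¬ ∃ w : m.out → A, FamH (z * b) (z * b) w)
    (hsm : ∀ κ < m, ∀ z, IsCentralProj z → z * a ≠ 0 → ∃ z', IsCentralProj z' ∧
      z' * (z * a) ≠ 0 ∧ ∃ w : κ.out → A, FamH (z' * (z * a)) (z' * (z * a)) w) :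
    ∃ z, IsCentralProj z ∧ z * a ≠ 0 ∧ SubE (z * b) (z * a) := by
  obtain ⟨W, hWW, hW, S, hS, bS, z, hz, hz0, hzr⟩ := lemE hAW ha hb ha0 {a} rfl (by
    refine ⟨?_, ?_, ?_⟩
    · intro i
      show star i.1 * i.1 = a
      rw [show i.1 = a from i.2, ha.1, ha.2]
    · intro i
      show b * i.1 = i.1
      rw [show i.1 = a from i.2, hab]
    · intro i j h
      exact absurd (Subsingleton.elim i j) h)
  have haW : a ∈ W := hWW rfl
  obtain ⟨z2, hz2, hz20, x, hx⟩ := doubling hAW (hz.mul_proj ha) (hinf z hz hz0)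
  have key : ∀ z', IsCentralProj z' → z' * (z * a) ≠ 0 →
      (∃ y : W → A, FamH (z' * (z * a)) (z' * (z * a)) y) →
      (∃ x : ℕ → A, FamH (z' * (z * a)) (z' * (z * a)) x) →
      ∃ z, IsCentralProj z ∧ z * a ≠ 0 ∧ SubE (z * b) (z * a) := by
    rintro z' hz' hne ⟨y, hy⟩ ⟨x, hx⟩
    have hzz := hz'.mul hz
    refine ⟨z' * z, hzz, by rwa [mul_assoc], ?_⟩
    rw [← mul_assoc] at hy hx
    refine lemX0 hAW (⟨a, haW⟩ : W) (hzz.mul_proj ha) (hzz.mul_proj hb) (hW.central hzz) rfl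
      (hW.cut hS hzz) ?_ hy hx
    have := hzr.central hz'
    rw [← mul_sub, mul_assoc, mul_assoc]
    exact this
  have hb0 : ∀ u, u * a ≠ 0 → u * b ≠ 0 := fun u hu h => hu (by rw [← hab, ← mul_assoc, h, zero_mul])
  rcases finite_or_infinite W with hfin | hinfW
  · obtain ⟨n, ⟨en⟩⟩ := Finite.exists_equiv_fin W
    exact key z2 hz2 hz20 ⟨_, hx.comp (fun i => (en i : ℕ))
      (fun i j h => en.injective (Fin.ext h))⟩ ⟨x, hx⟩
  · obtain ⟨w', hw'⟩ := lemD hAW (hz.mul_proj ha) (hz.mul_proj hb) (hW.central hz) (hW.cut hS hz)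
      (by rw [← mul_sub]; exact hzr)
    have hlt : Cardinal.mk W < m := by
      by_contra hge
      rw [not_lt] at hge
      rw [← Cardinal.mk_out m, Cardinal.le_def] at hge
      obtain ⟨f⟩ := hge
      exact hq z hz (hb0 z hz0) ⟨_, hw'.comp _ f.injective⟩
    obtain ⟨z3, hz3, hz30, y, hy⟩ := hsm _ hlt (z2 * z) (hz2.mul hz) (by rwa [mul_assoc])
    have hx' := hx.central hz3
    have hzz : z3 * (z2 * z * a) = (z3 * z2) * (z * a) := by simp only [mul_assoc]
    have eqv : Nonempty (W ≃ (Cardinal.mk W).out) :=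
      Cardinal.eq.1 (Cardinal.mk_out _).symm
    obtain ⟨eqv⟩ := eqv
    rw [hzz] at hy hz30
    refine key (z3 * z2) (hz3.mul hz2) hz30 ⟨_, hy.comp eqv eqv.injective⟩ ?_
    rw [← mul_assoc] at hx'
    exact ⟨_, hx'⟩


theorem masa_sa {M : StarSubalgebra ℂ A} (hM : IsMaximalAbelian M) {x : A} (hx : star x = x)
    (h : ∀ m ∈ M, m * x = x * m) : x ∈ M := by
  have hc : ∀ a ∈ (M : Set A) ∪ {x}, ∀ b ∈ (M : Set A) ∪ {x}, a * b = b * a := by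
    rintro a (ha | ha) b (hb | hb)
    · exact hM.1 a ha b hb
    · rw [show b = x from hb]; exact h a ha
    · rw [show a = x from ha]; exact (h b hb).symm
    · rw [show a = x from ha, show b = x from hb]
  have hs : ∀ b ∈ (M : Set A) ∪ {x}, star b ∈ (M : Set A) ∪ {x} := by
    rintro b (hb | hb)
    · exact Or.inl (star_mem (s := M) hb)
    · right
      rw [show b = x from hb]; exact hx
  have hN := StarAlgebra.isMulCommutative_adjoin ℂ hc (fun a ha b hb => hc a ha _ (hs b hb))
  have h1 := hM.2 (StarAlgebra.adjoin ℂ ((M : Set A) ∪ {x})) (fun a ha b hb => by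
    have := hN.is_comm.comm ⟨a, ha⟩ ⟨b, hb⟩
    exact congrArg Subtype.val this)
    (fun a ha => StarAlgebra.subset_adjoin ℂ _ (Or.inl ha))
  rw [h1]
  exact StarAlgebra.subset_adjoin ℂ _ (Or.inr rfl)

theorem masa_comm {M : StarSubalgebra ℂ A} (hM : IsMaximalAbelian M) {x : A}
    (h : ∀ m ∈ M, m * x = x * m) : x ∈ M := by
  have h' : ∀ m ∈ M, m * star x = star x * m := fun m hm => by
    have := congrArg star (h (star m) (star_mem hm))
    simpa using this.symm
  have h1 : x + star x ∈ M := masa_sa hM (by simp [add_comm])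
    (fun m hm => by rw [mul_add, add_mul, h m hm, h' m hm])
  have h2 : Complex.I • (x - star x) ∈ M := masa_sa hM (by simp [← smul_neg])
    (fun m hm => by rw [mul_smul_comm, smul_mul_assoc, mul_sub, sub_mul, h m hm, h' m hm])
  have h3 : (2⁻¹ : ℂ) • ((x + star x) + (-Complex.I) • (Complex.I • (x - star x))) ∈ M :=
    M.smul_mem (add_mem h1 (M.smul_mem h2 _)) _
  have h4 : (2⁻¹ : ℂ) • ((x + star x) + (-Complex.I) • (Complex.I • (x - star x))) = x := by
    rw [smul_smul, neg_mul, Complex.I_mul_I, neg_neg, one_smul]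
    have : x + star x + (x - star x) = (2 : ℂ) • x := by rw [two_smul]; abel
    rw [this, smul_smul]
    norm_num
  rwa [h4] at h3

theorem masa_ann (hAW : IsAWStarRing A) {M : StarSubalgebra ℂ A} (hM : IsMaximalAbelian M)
    {y : A} (hy : y ∈ M) : ∃ r ∈ M, IsProjection r ∧ y * r = 0 ∧ ∀ x, y * x = 0 → r * x = x := by
  obtain ⟨r, hr, h1, h2⟩ := ann_single hAW {y}
  have h1' : y * r = 0 := h1 y rfl
  have h2' : ∀ x, y * x = 0 → r * x = x := fun x hx => h2 x (by simpa using hx)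
  refine ⟨r, masa_comm hM fun m hm => ?_, hr, h1', h2'⟩
  have k : ∀ m ∈ M, r * (m * r) = m * r := fun m hm => h2' _ (by
    rw [← mul_assoc, hM.1 y hy m hm, mul_assoc, h1', mul_zero])
  have k1 := k m hm
  have k2 := congrArg star (k (star m) (star_mem hm))
  simp only [star_mul, star_star, hr.1] at k2
  rw [← k2, ← k1, mul_assoc]

theorem masa_step (hAW : IsAWStarRing A) {M : StarSubalgebra ℂ A} (hM : IsMaximalAbelian M)
    {m : A} (hm : m ∈ M) (hsa : star m = m) {c : ℝ} (hc : ‖m‖ ≤ c) :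
    ∃ m' ∈ M, star m' = m' ∧ ‖m'‖ ≤ c / 2 ∧ ∀ x, (∀ e ∈ M, IsProjection e → e * x = x * e) →
      m * x - x * m = m' * x - x * m' := by
  rcases subsingleton_or_nontrivial A with hA | hA
  · exact ⟨m, hm, hsa, by
      rw [Subsingleton.elim m 0] at hc ⊢
      simp at hc ⊢
      linarith, fun x _ => Subsingleton.elim _ _⟩
  let _ : CStarAlgebra A := {}
  have hc0 : 0 ≤ c := (norm_nonneg m).trans hc
  have hma : IsSelfAdjoint m := hsa
  have hmem : ∀ f : ℝ → ℝ, cfc f m ∈ M := fun f => masa_comm hM fun y hy => by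
    have : Commute m y := hM.1 m hm y hy
    exact (this.cfc_real f).eq.symm
  set a := cfc (fun t : ℝ => max t 0) m with ha
  set b := cfc (fun t : ℝ => max (-t) 0) m with hb
  have hab : a * b = 0 := by
    rw [ha, hb, ← cfc_mul _ _ m (by fun_prop) (by fun_prop)]
    rw [← cfc_const_zero ℝ m]
    apply cfc_congr
    intro t _
    show max t 0 * max (-t) 0 = 0
    rcases le_total t 0 with h | h
    · rw [max_eq_right h, zero_mul]
    · rw [max_eq_right (by linarith : -t ≤ 0), mul_zero]
  have hamb : a - b = m := by
    rw [ha, hb, ← cfc_sub _ _ m (by fun_prop) (by fun_prop)]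
    conv_rhs => rw [← cfc_id ℝ m]
    apply cfc_congr
    intro t _
    show max t 0 - max (-t) 0 = t
    rcases le_total t 0 with h | h
    · rw [max_eq_right h, max_eq_left (by linarith)]; ring
    · rw [max_eq_right (by linarith : -t ≤ 0), max_eq_left h]; ring
  set k := cfc (fun t : ℝ => |t| - c / 2) m with hk
  have hkab : k = a + b - algebraMap ℝ A (c / 2) := by
    rw [hk, cfc_sub _ _ m (by fun_prop) (by fun_prop), cfc_const _ m, ha, hb,
      ← cfc_add m _ _ (by fun_prop) (by fun_prop)]
    congr 1
    apply cfc_congr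
    intro t _
    show |t| = max t 0 + max (-t) 0
    rcases le_total t 0 with h | h
    · rw [max_eq_right h, max_eq_left (by linarith), abs_of_nonpos h]; ring
    · rw [max_eq_right (by linarith : -t ≤ 0), max_eq_left h, abs_of_nonneg h]; ring
  have hkn : ‖k‖ ≤ c / 2 := by
    apply norm_cfc_le (by positivity)
    intro t ht
    have h1 : ‖t‖ ≤ ‖m‖ := spectrum.norm_le_norm_of_mem ht
    rw [Real.norm_eq_abs] at h1 ⊢
    have h2 := abs_nonneg t
    rw [abs_le]
    constructor <;> linarith
  have hksa : star k = k := (cfc_predicate (R := ℝ) (p := IsSelfAdjoint) _ m : IsSelfAdjoint k)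
  have hasa : star a = a := (cfc_predicate (R := ℝ) (p := IsSelfAdjoint) _ m : IsSelfAdjoint a)
  obtain ⟨r, hrM, hr, r1, r2⟩ := masa_ann hAW hM (hmem (fun t : ℝ => max t 0))
  have rb : r * b = b := r2 b hab
  have ra : r * a = 0 := by
    have := congrArg star r1
    rw [star_mul, hr.1, star_zero] at this
    rw [← hasa]; exact this
  set u := 1 - 2 * r with hu
  have hur : u * (a + b) = m := by
    rw [hu, sub_mul, one_mul, mul_assoc, mul_add, ra, rb, zero_add, two_mul, ← hamb]; abel
  have husa : star u = u := by simp [hu, hr.1, two_mul]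
  have huu : u * u = 1 := by
    rw [hu]
    have : (1 - 2 * r) * (1 - 2 * r) = 1 - 4 * r + 4 * (r * r) := by noncomm_ring
    rw [this, hr.2]; abel
  have hun : ‖u‖ ≤ 1 := by
    have h1 : ‖star u * u‖ = ‖u‖ * ‖u‖ := CStarRing.norm_star_mul_self
    rw [husa, huu, norm_one] at h1
    nlinarith [norm_nonneg u]
  have huM : u ∈ M := sub_mem (one_mem _) (by rw [two_mul]; exact add_mem hrM hrM)
  refine ⟨u * k, mul_mem huM (hmem _), ?_, ?_, ?_⟩
  · rw [star_mul, husa, hksa, hM.1 _ huM _ (hmem _)]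
  · calc ‖u * k‖ ≤ ‖u‖ * ‖k‖ := norm_mul_le _ _
      _ ≤ 1 * (c / 2) := by gcongr
      _ = c / 2 := one_mul _
  · intro x hx
    have hxr := hx r hrM hr
    have hxu : u * x = x * u := by rw [hu, sub_mul, mul_sub, mul_assoc, hxr, two_mul, two_mul, mul_add]; simp
    have e1 : u * k = m - u * algebraMap ℝ A (c / 2) := by rw [hkab, mul_sub, hur]
    have e2 : u * algebraMap ℝ A (c / 2) * x = x * (u * algebraMap ℝ A (c / 2)) := by
      rw [← mul_assoc, ← hxu, mul_assoc, mul_assoc, Algebra.commutes]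
    rw [e1, sub_mul, mul_sub, e2]; abel

theorem masa_proj_comm (hAW : IsAWStarRing A) {M : StarSubalgebra ℂ A} (hM : IsMaximalAbelian M)
    {x : A} (hx : ∀ e ∈ M, IsProjection e → e * x = x * e) : x ∈ M := by
  have hsa : ∀ m ∈ M, star m = m → m * x = x * m := by
    intro m hm hs
    have key : ∀ n : ℕ, ∃ m' ∈ M, star m' = m' ∧ ‖m'‖ ≤ ‖m‖ * (1 / 2) ^ n ∧
        m * x - x * m = m' * x - x * m' := by
      intro n
      induction n with
      | zero => exact ⟨m, hm, hs, by simp, rfl⟩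
      | succ n ih =>
        obtain ⟨m1, h1, h2, h3, h4⟩ := ih
        obtain ⟨m2, k1, k2, k3, k4⟩ := masa_step hAW hM h1 h2 h3
        exact ⟨m2, k1, k2, by rw [pow_succ]; linarith, h4.trans (k4 x hx)⟩
    have hb : ∀ n : ℕ, ‖m * x - x * m‖ ≤ (2 * ‖m‖ * ‖x‖) * (1 / 2) ^ n := by
      intro n
      obtain ⟨m', -, -, h1, h2⟩ := key n
      rw [h2]
      calc ‖m' * x - x * m'‖ ≤ ‖m' * x‖ + ‖x * m'‖ := norm_sub_le _ _
        _ ≤ ‖m'‖ * ‖x‖ + ‖x‖ * ‖m'‖ := add_le_add (norm_mul_le _ _) (norm_mul_le _ _)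
        _ = 2 * ‖x‖ * ‖m'‖ := by ring
        _ ≤ 2 * ‖x‖ * (‖m‖ * (1 / 2) ^ n) := by gcongr
        _ = _ := by ring
    have ht : Filter.Tendsto (fun n : ℕ => (2 * ‖m‖ * ‖x‖) * (1 / 2 : ℝ) ^ n) Filter.atTop
        (nhds ((2 * ‖m‖ * ‖x‖) * 0)) :=
      (tendsto_pow_atTop_nhds_zero_of_lt_one (by norm_num) (by norm_num)).const_mul _
    have := ge_of_tendsto' ht hb
    rw [mul_zero] at this
    exact sub_eq_zero.1 (norm_le_zero_iff.1 this)
  refine masa_comm hM fun m hm => ?_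
  have h1 := hsa (m + star m) (add_mem hm (star_mem hm)) (by simp [add_comm])
  have h2 := hsa (Complex.I • (m - star m)) (M.smul_mem (sub_mem hm (star_mem hm)) _)
    (by simp [← smul_neg])
  have h3 : (m - star m) * x = x * (m - star m) := by
    rw [mul_smul_comm, smul_mul_assoc] at h2
    exact smul_right_injective A Complex.I_ne_zero h2
  have h4 : (2 : ℂ) • (m * x) = (2 : ℂ) • (x * m) := by
    rw [two_smul, two_smul]
    have := congrArg₂ (· + ·) h1 h3
    simp only [add_mul, sub_mul, mul_add, mul_sub] at this
    have e1 : m * x + m * x = m * x + star m * x + (m * x - star m * x) := by abel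
    have e2 : x * m + x * m = x * m + x * star m + (x * m - x * star m) := by abel
    rw [e1, e2, this]
  exact smul_right_injective A (two_ne_zero) h4

theorem noncentral (hAW : IsAWStarRing A) {M : StarSubalgebra ℂ A} (hM : IsMaximalAbelian M)
    {q : A} (hqM : q ∈ M) (hq : IsProjection q) (hinf : ¬ ProjFinite q) :
    ∃ e ∈ M, IsProjection e ∧ q * e = e ∧ ∃ x, e * x * (q - e) ≠ 0 := by
  by_contra hcon
  push Not at hcon
  unfold ProjFinite at hinf
  push Not at hinf
  obtain ⟨f, hf, ⟨v, hv, hvf⟩, hfp, hne⟩ := hinf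
  have hfp' : f * q = f := hfp
  have qf : q * f = f := star_eq_of' hq hf hfp'
  have fv : f * v = v := by rw [← hvf]; exact pi_left hq hv
  have qv : q * v = v := by rw [← fv, ← mul_assoc, qf]
  have vq : v * q = v := pi_right hq hv
  have hvM : v ∈ M := masa_proj_comm hAW hM fun e he hep => by
    have heq := hM.1 e he q hqM
    have hgM : q * e ∈ M := mul_mem hqM he
    have hg : IsProjection (q * e) := by
      refine ⟨by rw [star_mul, hq.1, hep.1, heq], ?_⟩
      rw [mul_assoc, ← mul_assoc e, heq, mul_assoc, hep.2, ← mul_assoc, hq.2]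
    have qg : q * (q * e) = q * e := by rw [← mul_assoc, hq.2]
    have h1 := hcon _ hgM hg qg v
    have hg' : IsProjection (q - q * e) := proj_sub hq hg qg
    have h2 := hcon (q - q * e) (sub_mem hqM hgM) hg' (by rw [mul_sub, hq.2, qg]) v
    rw [sub_sub_cancel, sub_mul, qv, sub_mul, sub_eq_zero] at h2
    rw [mul_sub, sub_eq_zero, mul_assoc, vq] at h1
    calc e * v = (q * e) * v := by rw [← heq, mul_assoc, qv]
      _ = v * (q * e) := by rw [h1, h2]
      _ = v * e := by rw [← mul_assoc, vq]
  apply hne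
  rw [← hvf, ← hv, hM.1 v hvM _ (star_mem hvM)]


theorem FamH.push {p g h : A} {ι : Type*} {w : ι → A} (hw : FamH p h w) (hv : SubE h g) :
    ∃ w' : ι → A, FamH p g w' := by
  obtain ⟨v, hv1, hv2⟩ := hv
  have key : ∀ i j, star (v * w i) * (v * w j) = star (w i) * w j := fun i j => by
    rw [star_mul, mul_assoc, ← mul_assoc (star v), hv1, hw.2.1]
  exact ⟨fun i => v * w i, fun i => by rw [key, hw.1], fun i => by rw [← mul_assoc, hv2],
    fun i j hij => by rw [key, hw.2.2 i j hij]⟩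

theorem local_half (hAW : IsAWStarRing A) {M : StarSubalgebra ℂ A} (hM : IsMaximalAbelian M)
    (hMinf : ∀ p : A, p ∈ M → IsProjection p → p ≠ 0 → ProperlyInfinite p)
    {p0 : A} (hp0M : p0 ∈ M) (hp0 : IsProjection p0) (hp00 : p0 ≠ 0) :
    ∃ p ∈ M, IsProjection p ∧ p ≠ 0 ∧ p0 * p = p ∧ ∃ p' ∈ M, IsProjection p' ∧ p * p' = p' ∧
      (∃ x : ℕ → A, FamH p p' x) ∧ ∃ y : ℕ → A, FamH p (p - p') y := by
  have zM : ∀ z, IsCentralProj z → z ∈ M := fun z hz => masa_comm hM fun m _ => (hz.2 m).symm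
  let K : Set Cardinal.{u} := {κ | ∃ p ∈ M, IsProjection p ∧ p ≠ 0 ∧ p0 * p = p ∧
    ∀ z, IsCentralProj z → z * p ≠ 0 → ¬ ∃ w : κ.out → A, FamH (z * p) (z * p) w}
  have hK : K.Nonempty := by
    refine ⟨Order.succ (Cardinal.mk A), p0, hp0M, hp0, hp00, hp0.2, ?_⟩
    rintro z hz hz0 ⟨w, hw⟩
    have h1 := Cardinal.mk_le_of_injective (hw.inj hz0)
    rw [Cardinal.mk_out] at h1
    exact absurd (Order.lt_succ (Cardinal.mk A)) (not_lt.2 h1)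
  obtain ⟨m, ⟨q, hqM, hq, hq0, hqp, hqm⟩, hmin⟩ := WellFounded.has_min Cardinal.lt_wf K hK
  have X : ∀ a ∈ M, IsProjection a → a ≠ 0 → q * a = a →
      ∃ z, IsCentralProj z ∧ z * a ≠ 0 ∧ SubE (z * q) (z * a) := by
    intro a haM ha ha0 hqa
    refine lemX hAW ha hq ha0 hqa m (hMinf a haM ha ha0).2.2 hqm ?_
    intro κ hκ z hz hza
    have h1 : κ ∉ K := fun h => hmin κ h hκ
    by_contra hcon
    push Not at hcon
    apply h1
    refine ⟨z * a, mul_mem (zM z hz) haM, hz.mul_proj ha, hza, ?_, ?_⟩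
    · rw [← mul_assoc, ← hz.2, mul_assoc, ← hqa, ← mul_assoc p0, hqp]
    · rintro z' hz' hne ⟨w, hw⟩
      exact hcon z' hz' hne w hw
  have hinf : ∀ z, IsCentralProj z → z * q ≠ 0 → ¬ ProjFinite (z * q) := (hMinf q hqM hq hq0).2.2
  obtain ⟨e, heM, he, hqe, x, hx⟩ := noncentral hAW hM hqM hq (by
    have := hinf 1 ⟨⟨star_one _, one_mul 1⟩, fun a => by simp⟩ (by simpa using hq0)
    simpa using this)
  have hg : IsProjection (q - e) := proj_sub hq he hqe
  have hgM : q - e ∈ M := sub_mem hqM heM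
  have qg : q * (q - e) = q - e := by rw [mul_sub, hq.2, hqe]
  obtain ⟨c, hc, hcg, hcw⟩ := ccover hAW (q - e)
  have hce : c * e ≠ 0 := by
    intro h
    apply hx
    rw [← hcg, ← mul_assoc, ← hc.2, ← mul_assoc, h]
    simp
  have qz : ∀ z, IsCentralProj z → ∀ a, q * a = a → q * (z * a) = z * a := fun z hz a h => by
    rw [← mul_assoc, ← hz.2, mul_assoc, h]
  obtain ⟨z1, hz1, hz10, hs1⟩ := X (c * e) (mul_mem (zM c hc) heM) (hc.mul_proj he) hce
    (qz c hc e hqe)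
  have hs1' := hs1.central hc
  obtain ⟨y, hy⟩ : ∃ y, y = c * z1 := ⟨_, rfl⟩
  have hyc : IsCentralProj y := by rw [hy]; exact hc.mul hz1
  have hcc : y * c = y := by rw [hy, mul_assoc, ← hc.2 z1, ← mul_assoc, hc.1.2]
  have hs2 : SubE (y * q) (y * e) := by
    rw [← mul_assoc, ← mul_assoc, ← mul_assoc, ← hy, hcc] at hs1'
    exact hs1'
  have hye : y ≠ 0 := by
    intro h
    apply hz10
    rw [← mul_assoc, ← hc.2, ← hy, h, zero_mul]
  have hyg : y * (q - e) ≠ 0 := by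
    intro h
    apply hye
    have := hcw y (fun x => by rw [← hyc.2, ← mul_assoc, h, zero_mul])
    rwa [hc.2, hcc] at this
  obtain ⟨z2, hz2, hz20, hs3⟩ := X (y * (q - e)) (mul_mem (zM y hyc) hgM) (hyc.mul_proj hg) hyg
    (qz y hyc _ qg)
  have hz := hz2.mul hyc
  have hs3' := hs3.central hyc
  have hs2' := hs2.central hz2
  set z := z2 * y with hzd
  have hyz : y * z2 = z := by rw [hzd, hyc.2]
  have hzy : z * y = z := by rw [hzd, mul_assoc, hyc.1.2]
  rw [← mul_assoc, ← mul_assoc, ← mul_assoc, hyz, hzy] at hs3'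
  rw [← mul_assoc, ← mul_assoc] at hs2'
  have hzq : z * q ≠ 0 := by
    intro h
    apply hz20
    rw [← mul_assoc, ← hzd, ← qg, ← mul_assoc, h, zero_mul]
  obtain ⟨z3, hz3, hz30, w, hw⟩ := doubling hAW (hz.mul_proj hq) (hinf z hz hzq)
  refine ⟨z3 * (z * q), mul_mem (zM _ hz3) (mul_mem (zM _ hz) hqM), hz3.mul_proj (hz.mul_proj hq),
    hz30, ?_, z3 * (z * e), mul_mem (zM _ hz3) (mul_mem (zM _ hz) heM),
    hz3.mul_proj (hz.mul_proj he), ?_, ?_, ?_⟩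
  · have hzz := hz3.mul hz
    rw [← mul_assoc z3, ← mul_assoc, ← hzz.2, mul_assoc, hqp]
  · rw [hz3.mm, hz.mm, hqe]
  · exact hw.push (hs2'.central hz3)
  · rw [← mul_sub, ← mul_sub]
    exact hw.push (hs3'.central hz3)

theorem sum_orth {ι κ : Type*} {p : ι → A} {r : κ → A} {s t : A} (hs : IsSumH p s)
    (ht : IsSumH r t) (hp : ∀ i, IsProjection (p i)) (h : ∀ i j, p i * r j = 0) : s * t = 0 := by
  have h1 : ∀ i, p i * t = 0 := fun i => ht.orth (h i)
  have h2 : t * s = 0 := hs.orth fun i => orth_symm (hp i) ht.1 (h1 i)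
  exact orth_symm ht.1 hs.1 h2

theorem glue (hAW : IsAWStarRing A) {ι : Type*} {p p' p'' : ι → A} {e f : A}
    {x y : ι → ℕ → A} (hp : ∀ i, IsProjection (p i))
    (hp' : ∀ i, IsProjection (p' i)) (hp'' : ∀ i, IsProjection (p'' i))
    (hpp' : ∀ i, p i * p' i = p' i) (hpp'' : ∀ i, p i * p'' i = p'' i)
    (ho' : ∀ i j, i ≠ j → p' i * p' j = 0) (ho'' : ∀ i j, i ≠ j → p'' i * p'' j = 0)
    (he : IsSumH p' e) (hf : IsSumH p'' f) (hef : e * f = 0) (h1 : e + f = 1)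
    (hx : ∀ i, FamH (p i) (p' i) (x i)) (hy : ∀ i, FamH (p i) (p'' i) (y i)) : SubE 1 e := by
  have cp : ∀ n i, IsProjection (x i n * star (x i n)) := fun n i => (hx i).proj (hp i) n
  have cq : ∀ i, IsProjection (y i 0 * star (y i 0)) := fun i => (hy i).proj (hp i) 0
  have lp : ∀ n i, p' i * (x i n * star (x i n)) = x i n * star (x i n) := fun n i => by
    rw [← mul_assoc, (hx i).2.1]
  have lq : ∀ i, p'' i * (y i 0 * star (y i 0)) = y i 0 * star (y i 0) := fun i => by
    rw [← mul_assoc, (hy i).2.1]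
  have rp : ∀ n i, (x i n * star (x i n)) * p' i = x i n * star (x i n) := fun n i =>
    star_eq_of (hp' i) (cp n i) (lp n i)
  have rq : ∀ i, (y i 0 * star (y i 0)) * p'' i = y i 0 * star (y i 0) := fun i =>
    star_eq_of (hp'' i) (cq i) (lq i)
  have op : ∀ n k i j, i ≠ j → (x i n * star (x i n)) * (x j k * star (x j k)) = 0 := by
    intro n k i j hij
    rw [← rp n i, ← lp k j, mul_assoc, ← mul_assoc (p' i), ho' i j hij, zero_mul, mul_zero]
  have oq : ∀ i j, i ≠ j → (y i 0 * star (y i 0)) * (y j 0 * star (y j 0)) = 0 := by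
    intro i j hij
    rw [← rq i, ← lq j, mul_assoc, ← mul_assoc (p'' i), ho'' i j hij, zero_mul, mul_zero]
  obtain ⟨Q1, hQ1⟩ := exists_isSum hAW _ (cp 0)
  obtain ⟨Q2, hQ2⟩ := exists_isSum hAW _ (cp 1)
  obtain ⟨Q3, hQ3⟩ := exists_isSum hAW _ cq
  have eQ1 : e * Q1 = Q1 := hQ1.le fun i => by rw [← lp, ← mul_assoc, he.2.1]
  have eQ2 : e * Q2 = Q2 := hQ2.le fun i => by rw [← lp, ← mul_assoc, he.2.1]
  have fQ3 : f * Q3 = Q3 := hQ3.le fun i => by rw [← lq, ← mul_assoc, hf.2.1]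
  have fe : f * e = 0 := orth_symm he.1 hf.1 hef
  have h3 : e * Q3 = 0 := by rw [← fQ3, ← mul_assoc, hef, zero_mul]
  have h4 : f * Q1 = 0 := by rw [← eQ1, ← mul_assoc, fe, zero_mul]
  have h5 : Q3 * Q2 = 0 := by
    rw [← star_eq_of hf.1 hQ3.1 fQ3, ← eQ2, mul_assoc, ← mul_assoc f, fe, zero_mul, mul_zero]
  have h6 : Q2 * Q1 = 0 := by
    refine sum_orth hQ2 hQ1 (cp 1) fun i j => ?_
    by_cases hij : i = j
    · subst hij
      exact (hx i).orth 1 0 (by norm_num)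
    · exact op 1 0 i j hij
  have toP : ∀ n i, SubE (p i) (x i n * star (x i n)) := fun n i =>
    ⟨x i n, (hx i).1 n, pi_left (hp i) ((hx i).1 n)⟩
  have toQ : ∀ i, SubE (p i) (y i 0 * star (y i 0)) := fun i =>
    ⟨y i 0, (hy i).1 0, pi_left (hp i) ((hy i).1 0)⟩
  have fromQ : ∀ i, SubE (y i 0 * star (y i 0)) (p i) := fun i =>
    ⟨star (y i 0), by simp, by
      have := congrArg star (pi_right (hp i) ((hy i).1 0))
      simpa [(hp i).1] using this⟩
  have s1 : SubE e Q3 := SubE.sum hAW he hQ3.1 hQ3.2.1 hp' cq ho' oq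
    (fun i => (SubE.of_le (hp' i) (hpp' i)).trans (toQ i)) h3
  have s2 : SubE Q3 Q2 := SubE.sum hAW hQ3 hQ2.1 hQ2.2.1 cq (cp 1) oq (op 1 1)
    (fun i => (fromQ i).trans (toP 1 i)) h5
  have s3 : SubE f Q1 := SubE.sum hAW hf hQ1.1 hQ1.2.1 hp'' (cp 0) ho'' (op 0 0)
    (fun i => (SubE.of_le (hp'' i) (hpp'' i)).trans (toP 0 i)) h4
  have s4 := SubE.add hQ2.1 hQ1.1 (s1.trans s2) s3 h6
  rw [h1] at s4
  exact s4.trans (SubE.of_le (proj_add hQ2.1 hQ1.1 h6) (by rw [mul_add, eQ1, eQ2]))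

theorem main_aux (hAW : IsAWStarRing A) (M : StarSubalgebra ℂ A) (hM : IsMaximalAbelian M)
    (hMinf : ∀ p : A, p ∈ M → IsProjection p → p ≠ 0 → ProperlyInfinite p) :
    ∃ e : A, e ∈ M ∧ IsProjection e ∧ ProjEquiv e 1 ∧ ProjEquiv (1 - e) 1 := by
  obtain ⟨V, -, hP, hR, hmax⟩ := max_fam
    (fun p : A => p ∈ M ∧ IsProjection p ∧ p ≠ 0 ∧ ∃ p' ∈ M, IsProjection p' ∧ p * p' = p' ∧
      (∃ x : ℕ → A, FamH p p' x) ∧ ∃ y : ℕ → A, FamH p (p - p') y)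
    (fun v w => v * w = 0) ∅ (by simp) (by simp)
  have hpM : ∀ i : V, i.1 ∈ M := fun i => (hP i i.2).1
  have hp : ∀ i : V, IsProjection i.1 := fun i => (hP i i.2).2.1
  have hex := fun i : V => (hP i i.2).2.2.2
  choose p' hp'M hp' hpp' hx hy using hex
  choose x hx using hx
  choose y hy using hy
  have ho : ∀ i j : V, i ≠ j → i.1 * j.1 = 0 := fun i j hij =>
    hR i i.2 j j.2 fun h => hij (Subtype.ext h)
  obtain ⟨s, hs⟩ := exists_isSum hAW (fun i : V => i.1) hp
  have hsM : s ∈ M := masa_comm hM fun m hm => hs.commute hp fun i => hM.1 m hm _ (hpM i)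
  have hs1 : s = 1 := by
    by_contra hne
    obtain ⟨p, hpM', hpp, hp0, hle, hrest⟩ := local_half hAW hM hMinf
      (sub_mem (one_mem M) hsM) hs.1.compl (fun h => hne (sub_eq_zero.1 h).symm)
    have sp : s * p = 0 := by
      rw [← hle, ← mul_assoc, mul_sub, mul_one, hs.1.2, sub_self, zero_mul]
    have hpV : p ∈ V := hmax p ⟨hpM', hpp, hp0, hrest⟩ fun v hv => by
      have h1 : v * p = 0 := by
        have k : v * s = v := hs.mul_right hp ⟨v, hv⟩
        rw [← k, mul_assoc, sp, mul_zero]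
      exact ⟨h1, orth_symm (hp ⟨v, hv⟩) hpp h1⟩
    have := hs.2.1 ⟨p, hpV⟩
    exact hp0 (this.symm.trans sp)
  have hp'' : ∀ i : V, IsProjection (i.1 - p' i) := fun i => proj_sub (hp i) (hp' i) (hpp' i)
  have hpp'' : ∀ i : V, i.1 * (i.1 - p' i) = i.1 - p' i := fun i => by
    rw [mul_sub, (hp i).2, hpp']
  have gen : ∀ (i j : V) (a b : A), i ≠ j → IsProjection a → i.1 * a = a → j.1 * b = b →
      a * b = 0 := by
    intro i j a b hij ha h1 h2
    rw [← star_eq_of (hp i) ha h1, ← h2, mul_assoc, ← mul_assoc i.1, ho i j hij, zero_mul, mul_zero]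
  obtain ⟨e, he⟩ := exists_isSum hAW p' hp'
  obtain ⟨f, hf⟩ := exists_isSum hAW (fun i : V => i.1 - p' i) hp''
  have hsame : ∀ i, p' i * (i.1 - p' i) = 0 := fun i => by
    rw [mul_sub, (hp' i).2, star_eq_of (hp i) (hp' i) (hpp' i), sub_self]
  have hef : e * f = 0 := sum_orth he hf hp' fun i j => by
    by_cases hij : i = j
    · subst hij; exact hsame i
    · exact gen i j _ _ hij (hp' i) (hpp' i) (hpp'' j)
  have hfe : f * e = 0 := orth_symm he.1 hf.1 hef
  have hsum : e + f = 1 := by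
    have h1 : (1 - (e + f)) * s = 0 := hs.2.2 _ fun i => by
      have k1 : e * p' i = p' i := he.2.1 i
      have k2 : f * (i.1 - p' i) = i.1 - p' i := hf.2.1 i
      have k3 : e * (i.1 - p' i) = 0 := by rw [← k2, ← mul_assoc, hef, zero_mul]
      have k4 : f * p' i = 0 := by rw [← k1, ← mul_assoc, hfe, zero_mul]
      rw [mul_sub, k1, sub_eq_zero] at k3
      rw [mul_sub, k4, sub_zero] at k2
      rw [sub_mul, add_mul, k3, k2]
      simp
    rw [hs1, mul_one, sub_eq_zero] at h1
    exact h1.symm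
  have hf1 : 1 - e = f := by rw [← hsum]; abel
  have ho' : ∀ i j, i ≠ j → p' i * p' j = 0 := fun i j hij =>
    gen i j _ _ hij (hp' i) (hpp' i) (hpp' j)
  have ho'' : ∀ i j : V, i ≠ j → (i.1 - p' i) * (j.1 - p' j) = 0 := fun i j hij =>
    gen i j _ _ hij (hp'' i) (hpp'' i) (hpp'' j)
  refine ⟨e, masa_comm hM fun m hm => he.commute hp' fun i => hM.1 m hm _ (hp'M i), he.1, ?_, ?_⟩
  · exact sb hAW he.1 (glue hAW hp hp' hp'' hpp' hpp'' ho' ho'' he hf hef hsum hx hy)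
  · rw [hf1]
    exact sb hAW hf.1 (glue hAW hp hp'' hp' hpp'' hpp' ho'' ho' hf he hfe
      (by rw [add_comm]; exact hsum) hy hx)


end Helpers


/-- If all nonzero projections of a maximal abelian subalgebra `M` of an
AW*-algebra `A` are properly infinite, then `M` contains a projection `e` with
`e ∼ 1 ∼ 1 - e`. -/
theorem masa_halving_of_properlyInfinite {A : Type u} [NormedRing A] [StarRing A]
    [CStarRing A] [NormedAlgebra ℂ A] [StarModule ℂ A] [CompleteSpace A]
    (hAW : IsAWStarRing A)
    (M : StarSubalgebra ℂ A) (hM : IsMaximalAbelian M)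
    (hMinf : ∀ p : A, p ∈ M → IsProjection p → p ≠ 0 → ProperlyInfinite p) :
    ∃ e : A, e ∈ M ∧ IsProjection e ∧ ProjEquiv e 1 ∧ ProjEquiv (1 - e) 1 := by
  exact main_aux hAW M hM hMinf
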